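/- arXiv:2110.05716 — 4 statements merged into one kernel-verified Lean document; each statement's English description precedes it below -/
import Mathlib

section
/- Under Assumption 2.1, for every n ∈ {0,…,N} the following pathwise domination holds: if sup_{0≤k≤n−1} D_k ≤ N^{1/(2c)} and sup_{0≤k≤n−1} ‖ΔW_k‖ ≤ 1, then ‖Y_n‖ ≤ D_n. (Lemma 2.1, stated deterministically for arbitrary increment vectors ΔW_0,…,ΔW_{N−1} ∈ ℝ^m.) -/
open MeasureTheory ProbabilityTheory Real Finset
open scoped RealInnerProductSpace ENNReal NNReal

noncomputable section

abbrev Vec (n : ℕ) : Type := EuclideanSpace ℝ (Fin n)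

/-- The `d × m` matrix with columns `g j x`, viewed as a continuous linear map `ℝ^m → ℝ^d`. -/
def Gclm {d m : ℕ} (g : Fin m → Vec d → Vec d) (x : Vec d) : Vec m →L[ℝ] Vec d :=
  LinearMap.toContinuousLinearMap
  { toFun := fun w => ∑ j, w j • g j x
    map_add' := by
      intro w w'
      simp [PiLp.add_apply, add_smul, Finset.sum_add_distrib]
    map_smul' := by
      intro c w
      simp [PiLp.smul_apply, smul_smul, Finset.smul_sum] }

/-- `L^{j₁} g_{j₂} (x) = (Dg_{j₂})(x) · g_{j₁}(x)`. -/
def Lg {d m : ℕ} (g : Fin m → Vec d → Vec d) (j₁ j₂ : Fin m) (x : Vec d) : Vec d :=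
  fderiv ℝ (g j₂) x (g j₁ x)

/-- One step of the semi-tamed Milstein scheme with stepsize `h`, drift parts `ph` (Lipschitz)
and `ps` (tamed), diffusion columns `g`, current state `y` and Brownian increment `w`. -/
def milstep {d m : ℕ} (h : ℝ) (ph ps : Vec d → Vec d) (g : Fin m → Vec d → Vec d)
    (y : Vec d) (w : Vec m) : Vec d :=
  y + h • ph y + (h / (1 + ‖ps y‖ * h)) • ps y + Gclm g y w
    + (2⁻¹ : ℝ) • ∑ j₁, ∑ j₂, (w j₁ * w j₂ - (if j₁ = j₂ then h else 0)) • Lg g j₁ j₂ y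

/-- The quantity `α` associated with a state `y` and an increment `w`. -/
def alph {d m : ℕ} (h : ℝ) (g : Fin m → Vec d → Vec d) (y : Vec d) (w : Vec m) : ℝ :=
  if 1 ≤ ‖y‖ then
    ⟪‖y‖⁻¹ • y, ‖y‖⁻¹ • (Gclm g y w)⟫
      + ⟪‖y‖⁻¹ • y,
          (2 * ‖y‖)⁻¹ • ∑ j₁, ∑ j₂, (w j₁ * w j₂ - (if j₁ = j₂ then h else 0)) • Lg g j₁ j₂ y⟫
  else 0

/-- The constant `λ`. -/
def lamc {d m : ℕ} (T K : ℝ) (ph ps : Vec d → Vec d) (g : Fin m → Vec d → Vec d) : ℝ :=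
  (1 + 4 * T * K + 2 * T * (‖ph 0‖ + ‖ps 0‖) + 2 * K + 2 * ‖Gclm g 0‖
    + (m : ℝ) ^ 2 * (T + 1) * (K + ⨆ j : Fin m × Fin m, ‖Lg g j.1 j.2 0‖)) ^ 2

/-- The dominating process `D_n`, given `λ`, `‖ξ‖`, the squared increment norms and the `α`'s. -/
def Dproc (lam ξnorm : ℝ) (w2 al : ℕ → ℝ) (n : ℕ) : ℝ :=
  (lam + ξnorm) * Real.exp (lam +
    (Finset.range (n + 1)).sup' Finset.nonempty_range_add_one
      (fun u => ∑ k ∈ Finset.Ico u n, (lam * w2 k + al k)))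

end

noncomputable section

/-- A sequence whose steps are either reset below `lam` or grow by a controlled exponential factor
is dominated by `Dproc`. -/
lemma le_Dproc_of_step {lam x₀ : ℝ} {N n : ℕ} {r w2 al : ℕ → ℝ} (hN : 0 < N) (hn : n ≤ N)
    (hlam : 0 ≤ lam) (hx₀ : 0 ≤ x₀) (h0 : r 0 ≤ x₀)
    (hstep : ∀ k < n, r k ≤ Dproc lam x₀ w2 al k →
      r (k + 1) ≤ lam ∨ r (k + 1) ≤ r k * exp (lam / N + (lam * w2 k + al k))) :
    r n ≤ Dproc lam x₀ w2 al n := by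
  have hN' : (0 : ℝ) < N := by exact_mod_cast hN
  set S : ℕ → ℝ := fun k => (Finset.range (k + 1)).sup' Finset.nonempty_range_add_one
    (fun u => ∑ i ∈ Finset.Ico u k, (lam * w2 i + al i)) with hS
  have hS_nonneg : ∀ k, 0 ≤ S k := fun k => by
    have := Finset.le_sup' (fun u => ∑ i ∈ Finset.Ico u k, (lam * w2 i + al i))
      (Finset.self_mem_range_succ k)
    rwa [Finset.Ico_self, Finset.sum_empty] at this
  have hS_succ : ∀ k, S k + (lam * w2 k + al k) ≤ S (k + 1) := fun k => by
    rw [← le_sub_iff_add_le]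
    refine Finset.sup'_le _ _ fun u hu => ?_
    have huk : u ≤ k := Nat.lt_succ_iff.mp (Finset.mem_range.mp hu)
    rw [le_sub_iff_add_le, ← Finset.sum_Ico_succ_top huk]
    exact Finset.le_sup' (fun u => ∑ i ∈ Finset.Ico u (k + 1), (lam * w2 i + al i))
      (Finset.mem_range.mpr (by omega))
  have hle : ∀ k ≤ n, (lam + x₀) * exp (k * (lam / N) + S k) ≤ Dproc lam x₀ w2 al k := by
    intro k hk
    have hkN : (k : ℝ) ≤ N := by exact_mod_cast hk.trans hn
    have : k * (lam / N) ≤ lam := by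
      rw [← mul_div_assoc, div_le_iff₀ hN', mul_comm]
      gcongr
    unfold Dproc
    gcongr
  have key : ∀ k ≤ n, r k ≤ (lam + x₀) * exp (k * (lam / N) + S k) := by
    intro k
    induction k with
    | zero =>
      intro _
      have h1 : 1 ≤ exp (((0 : ℕ) : ℝ) * (lam / N) + S 0) :=
        one_le_exp (by simpa using hS_nonneg 0)
      nlinarith
    | succ k ih =>
      intro hk
      have hrk := ih (by omega)
      rcases hstep k (by omega) (hrk.trans (hle k (by omega))) with h | h
      · have h1 : 1 ≤ exp (((k + 1 : ℕ) : ℝ) * (lam / N) + S (k + 1)) :=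
          one_le_exp (add_nonneg (by positivity) (hS_nonneg _))
        nlinarith
      · calc r (k + 1) ≤ r k * exp (lam / N + (lam * w2 k + al k)) := h
          _ ≤ (lam + x₀) * exp (k * (lam / N) + S k) * exp (lam / N + (lam * w2 k + al k)) := by
            gcongr
          _ = (lam + x₀) * exp ((k + 1 : ℕ) * (lam / N) + (S k + (lam * w2 k + al k))) := by
            rw [mul_assoc, ← exp_add]
            push_cast
            ring_nf
          _ ≤ _ := by
            gcongr
            exact hS_succ k
  exact (key n le_rfl).trans (hle n le_rfl)

/-- A map whose derivative grows at most like `K * ‖x‖ ^ c` grows at most like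
`K * ‖x‖ ^ c * ‖x‖`. -/
lemma norm_le_of_norm_fderiv_le_rpow {E F : Type*} [NormedAddCommGroup E] [NormedSpace ℝ E]
    [NormedAddCommGroup F] [NormedSpace ℝ F] {f : E → F} {K c : ℝ} (hK : 0 ≤ K) (hc : 0 ≤ c)
    (hf : Differentiable ℝ f) (hf' : ∀ x, ‖fderiv ℝ f x‖ ≤ K * ‖x‖ ^ c) (x : E) :
    ‖f x‖ ≤ ‖f 0‖ + K * ‖x‖ ^ c * ‖x‖ := by
  have h := (convex_closedBall (0 : E) ‖x‖).norm_image_sub_le_of_norm_fderiv_le (𝕜 := ℝ) (f := f)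
    (C := K * ‖x‖ ^ c) (fun z _ => hf z)
    (fun z hz => (hf' z).trans (by
      have : ‖z‖ ≤ ‖x‖ := by simpa using hz
      gcongr))
    (x := 0) (y := x) (by simp) (by simp)
  rw [sub_zero] at h
  linarith [norm_le_norm_add_norm_sub' (f x) (f 0)]

/-- If `2⟪y, u⟫` and `‖u + a‖` are controlled by the norm of `y`, then so is `‖y + u + a‖`. -/
lemma norm_add_add_le_mul_exp {E : Type*} [NormedAddCommGroup E] [InnerProductSpace ℝ E]
    {y u a : E} {α β : ℝ} (ha : ⟪y, a⟫ = ‖y‖ ^ 2 * α)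
    (h : 2 * ⟪y, u⟫ + ‖u + a‖ ^ 2 ≤ ‖y‖ ^ 2 * (2 * β)) :
    ‖y + u + a‖ ≤ ‖y‖ * exp (β + α) := by
  refine le_of_sq_le_sq ?_ (by positivity)
  calc ‖y + u + a‖ ^ 2 = ‖y‖ ^ 2 + 2 * ⟪y, u⟫ + 2 * ⟪y, a⟫ + ‖u + a‖ ^ 2 := by
        rw [add_assoc y u a, norm_add_sq_real, inner_add_right]
        ring
    _ ≤ ‖y‖ ^ 2 * (2 * (β + α) + 1) := by rw [ha]; linarith
    _ ≤ ‖y‖ ^ 2 * exp (2 * (β + α)) := by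
        gcongr
        exact add_one_le_exp _
    _ = (‖y‖ * exp (β + α)) ^ 2 := by
        rw [mul_pow, ← exp_nat_mul]
        norm_cast

/-- A one-sided linear growth bound for `p + q` and a linear growth bound for `p` pass to
`p` plus tamed `q`. -/
lemma inner_add_tamed_le {E : Type*} [NormedAddCommGroup E] [InnerProductSpace ℝ E]
    {y p q : E} {h B : ℝ} (hh : 0 ≤ h) (hpq : ⟪y, p + q⟫ ≤ B) (hp : ⟪y, p⟫ ≤ B) :
    ⟪y, h • p + (h / (1 + ‖q‖ * h)) • q⟫ ≤ h * B := by
  have hpos : 0 < 1 + ‖q‖ * h := by positivity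
  set θ := (1 + ‖q‖ * h)⁻¹ with hθ
  have hθ0 : 0 ≤ θ := by positivity
  have hθ1 : θ ≤ 1 := inv_le_one_of_one_le₀ (by nlinarith [norm_nonneg q])
  rw [inner_add_right] at hpq
  rw [inner_add_right, inner_smul_right, inner_smul_right, div_eq_mul_inv, ← hθ, mul_assoc,
    ← mul_add]
  gcongr
  nlinarith

lemma norm_add_tamed_le {E : Type*} [NormedAddCommGroup E] [NormedSpace ℝ E]
    {p q : E} {h : ℝ} (hh : 0 ≤ h) :
    ‖h • p + (h / (1 + ‖q‖ * h)) • q‖ ≤ h * (‖p‖ + ‖q‖) := by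
  have hle : h / (1 + ‖q‖ * h) ≤ h :=
    div_le_self hh (by nlinarith [norm_nonneg q])
  calc _ ≤ ‖h • p‖ + ‖(h / (1 + ‖q‖ * h)) • q‖ := norm_add_le _ _
    _ = h * ‖p‖ + h / (1 + ‖q‖ * h) * ‖q‖ := by
      rw [norm_smul, norm_smul, norm_of_nonneg hh, norm_of_nonneg (by positivity)]
    _ ≤ _ := by rw [mul_add]; gcongr

lemma norm_milstein_correction_le {E : Type*} [NormedAddCommGroup E] [NormedSpace ℝ E] {m : ℕ}
    {h C : ℝ} (hh : 0 ≤ h) (w : Vec m) (L : Fin m → Fin m → E)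
    (hL : ∀ i j, ‖L i j‖ ≤ C) :
    ‖∑ i, ∑ j, (w i * w j - (if i = j then h else 0)) • L i j‖
      ≤ (m : ℝ) ^ 2 * ((‖w‖ ^ 2 + h) * C) := by
  have hterm : ∀ i j, ‖(w i * w j - (if i = j then h else 0)) • L i j‖ ≤ (‖w‖ ^ 2 + h) * C := by
    intro i j
    rw [norm_smul]
    have h1 : ‖w i * w j‖ ≤ ‖w‖ ^ 2 := by
      rw [norm_mul, sq]
      gcongr <;> exact PiLp.norm_apply_le w _
    have h2 : ‖(if i = j then h else 0)‖ ≤ h := by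
      split_ifs <;> simp [abs_of_nonneg hh, hh]
    exact mul_le_mul ((norm_sub_le _ _).trans (add_le_add h1 h2)) (hL i j) (norm_nonneg _)
      (by positivity)
  calc _ ≤ ∑ _i : Fin m, ∑ _j : Fin m, (‖w‖ ^ 2 + h) * C :=
        norm_sum_le_of_le _ fun i _ => norm_sum_le_of_le _ fun j _ => hterm i j
    _ = _ := by simp; ring

/-- A step starting in the unit ball lands in the ball of radius `lamc`. -/
lemma norm_step_le_of_norm_le_one {E : Type*} [NormedAddCommGroup E] {y u b s : E}
    {T K p q G M m2 : ℝ} (hT : 0 ≤ T) (hK : 0 ≤ K) (hp : 0 ≤ p) (hq : 0 ≤ q) (hG : 0 ≤ G)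
    (hM : 0 ≤ M) (hm2 : 0 ≤ m2) (hy : ‖y‖ ≤ 1) (hu : ‖u‖ ≤ T * ((p + K) + (q + K)))
    (hb : ‖b‖ ≤ G + K) (hs : ‖s‖ ≤ m2 * (T + 1) * (K + M)) :
    ‖y + u + (b + s)‖ ≤
      (1 + 4 * T * K + 2 * T * (p + q) + 2 * K + 2 * G + m2 * (T + 1) * (K + M)) ^ 2 := by
  have h := (norm_add₃_le (a := y) (b := u) (c := b + s)).trans
    (add_le_add_right (norm_add_le b s) _)
  have hTK : 0 ≤ T * K := by positivity
  have hTp : 0 ≤ T * p := by positivity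
  have hTq : 0 ≤ T * q := by positivity
  have hme : 0 ≤ m2 * (T + 1) * (K + M) := by positivity
  refine le_trans ?_ (le_self_pow₀ (by linarith) two_ne_zero)
  linarith

lemma add_sq_le_of_nonneg {κ a b e t r ω : ℝ} (ha : 0 ≤ a) (hb : 0 ≤ b) (he : 0 ≤ e) (ht : 0 ≤ t)
    (hκ : κ ≤ a) :
    2 * (r ^ 2 * κ) + (r * (a + t) + ω * (b + e)) ^ 2
      ≤ 2 * ((1 + 2 * a + 2 * b + 2 * e + 2 * t) ^ 2 * (r ^ 2 + ω ^ 2)) := by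
  have h1 : κ + (a + t) ^ 2 ≤ (1 + 2 * a + 2 * b + 2 * e + 2 * t) ^ 2 :=
    calc κ + (a + t) ^ 2 ≤ (1 + a + t) ^ 2 := by linarith [sq_nonneg (a + t)]
      _ ≤ _ := by gcongr ?_ ^ 2; linarith
  have h2 : (b + e) ^ 2 ≤ (1 + 2 * a + 2 * b + 2 * e + 2 * t) ^ 2 := by
    gcongr ?_ ^ 2
    linarith
  linarith [mul_le_mul_of_nonneg_left h1 (sq_nonneg r),
    mul_le_mul_of_nonneg_left h2 (sq_nonneg ω), sq_nonneg (r * (a + t) - ω * (b + e))]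

/-- The quadratic estimate behind the exponential growth bound. -/
lemma lamc_quadratic_estimate {T K p q G M m2 r ω : ℝ} (hT : 0 ≤ T) (hK : 0 ≤ K) (hp : 0 ≤ p)
    (hq : 0 ≤ q) (hG : 0 ≤ G) (hM : 0 ≤ M) (hm2 : 0 ≤ m2) :
    2 * (r ^ 2 * (T * (K + p + q))) +
        (r * (T * (p + q + 2 * K)) + ((G + K) * ω + m2 * (K + M) / 2 * (ω + r * T))) ^ 2 ≤
      2 * ((1 + 4 * T * K + 2 * T * (p + q) + 2 * K + 2 * G + m2 * (T + 1) * (K + M)) ^ 2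
        * (r ^ 2 + ω ^ 2)) := by
  have h := add_sq_le_of_nonneg (κ := T * (K + p + q)) (a := T * (p + q + 2 * K)) (b := G + K)
    (e := m2 * (K + M) / 2) (t := m2 * (K + M) / 2 * T) (r := r) (ω := ω) (by positivity)
    (by positivity) (by positivity) (by positivity) (mul_le_mul_of_nonneg_left (by linarith) hT)
  convert h using 2 <;> ring

lemma inner_eq_sq_mul_alph {d m : ℕ} {h : ℝ} {g : Fin m → Vec d → Vec d} {y : Vec d} {w : Vec m}
    (hy : 1 ≤ ‖y‖) :
    ⟪y, Gclm g y w + (2⁻¹ : ℝ) •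
        ∑ i, ∑ j, (w i * w j - (if i = j then h else 0)) • Lg g i j y⟫
      = ‖y‖ ^ 2 * alph h g y w := by
  have hy0 : ‖y‖ ≠ 0 := by positivity
  rw [alph, if_pos hy]
  simp only [inner_add_right, real_inner_smul_left, real_inner_smul_right]
  field_simp

set_option maxHeartbeats 1000000 in
/-- One step of the scheme either lands in the ball of radius `lamc` or grows by at most a
controlled exponential factor. -/
lemma norm_milstep_le {d m N : ℕ} (hN : 0 < N) {T : ℝ} (hT : 0 < T)
    {ph ps : Vec d → Vec d} {g : Fin m → Vec d → Vec d}
    {K c : ℝ} (hK : 1 ≤ K) (hc : 1 ≤ c)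
    (hOSL : ∀ x y : Vec d, ⟪x - y, (ph x + ps x) - (ph y + ps y)⟫ ≤ K * ‖x - y‖ ^ 2)
    (hgLip : ∀ x y : Vec d, ‖Gclm g x - Gclm g y‖ ≤ K * ‖x - y‖)
    (hphLip : ∀ x y : Vec d, ‖ph x - ph y‖ ≤ K * ‖x - y‖)
    (hpsC : ContDiff ℝ 1 ps)
    (hps' : ∀ x : Vec d, ‖fderiv ℝ ps x‖ ≤ K * ‖x‖ ^ c)
    (hLgLip : ∀ (j₁ j₂ : Fin m) (x y : Vec d), ‖Lg g j₁ j₂ x - Lg g j₁ j₂ y‖ ≤ K * ‖x - y‖)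
    {y : Vec d} {w : Vec m} (hy : ‖y‖ ≤ (N : ℝ) ^ ((1 : ℝ) / (2 * c))) (hw : ‖w‖ ≤ 1) :
    ‖milstep (T / N) ph ps g y w‖ ≤ lamc T K ph ps g ∨
      ‖milstep (T / N) ph ps g y w‖ ≤ ‖y‖ * exp (lamc T K ph ps g / N +
        (lamc T K ph ps g * ‖w‖ ^ 2 + alph (T / N) g y w)) := by
  have hN1 : (1 : ℝ) ≤ N := by exact_mod_cast hN
  have hK0 : 0 ≤ K := by linarith
  have hh0 : 0 ≤ T / N := by positivity
  have hhT : T / N ≤ T := div_le_self hT.le hN1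
  have hph : ‖ph y‖ ≤ ‖ph 0‖ + K * ‖y‖ := by
    have := hphLip y 0
    rw [sub_zero] at this
    linarith [norm_le_norm_add_norm_sub' (ph y) (ph 0)]
  have hps := norm_le_of_norm_fderiv_le_rpow hK0 (by linarith) (hpsC.differentiable one_ne_zero)
    hps' y
  have hG : ‖Gclm g y w‖ ≤ (‖Gclm g 0‖ + K * ‖y‖) * ‖w‖ := by
    refine (ContinuousLinearMap.le_opNorm _ _).trans ?_
    have := hgLip y 0
    rw [sub_zero] at this
    gcongr
    linarith [norm_le_norm_add_norm_sub' (Gclm g y) (Gclm g 0)]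
  set M : ℝ := ⨆ j : Fin m × Fin m, ‖Lg g j.1 j.2 0‖ with hM
  have hM0 : 0 ≤ M := Real.iSup_nonneg fun _ => norm_nonneg _
  have hL : ∀ i j, ‖Lg g i j y‖ ≤ M + K * ‖y‖ := by
    intro i j
    have := hLgLip i j y 0
    rw [sub_zero] at this
    have hle : ‖Lg g i j 0‖ ≤ M :=
      le_ciSup (f := fun j : Fin m × Fin m => ‖Lg g j.1 j.2 0‖) (Set.finite_range _).bddAbove (i, j)
    linarith [norm_le_norm_add_norm_sub' (Lg g i j y) (Lg g i j 0)]
  set u := (T / N) • ph y + (T / N / (1 + ‖ps y‖ * (T / N))) • ps y with hu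
  set s := (2⁻¹ : ℝ) •
    ∑ i, ∑ j, (w i * w j - (if i = j then T / N else 0)) • Lg g i j y with hs
  have hstep : milstep (T / N) ph ps g y w = y + u + (Gclm g y w + s) := by
    rw [milstep, hu, hs]
    abel
  have hu_le : ‖u‖ ≤ T / N * (‖ph y‖ + ‖ps y‖) := norm_add_tamed_le hh0
  have hs_le : ‖s‖ ≤ (m : ℝ) ^ 2 / 2 * ((‖w‖ ^ 2 + T / N) * (M + K * ‖y‖)) := by
    have := norm_milstein_correction_le hh0 w (fun i j => Lg g i j y) hL
    rw [hs, norm_smul, norm_of_nonneg (by norm_num)]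
    linarith
  rw [hstep]
  rcases le_total ‖y‖ 1 with hy1 | hy1
  · left
    have hyc : ‖y‖ ^ c * ‖y‖ ≤ 1 :=
      mul_le_one₀ (rpow_le_one (norm_nonneg _) hy1 (by linarith)) (norm_nonneg _) hy1
    have hKy : K * ‖y‖ ≤ K := mul_le_of_le_one_right hK0 hy1
    refine norm_step_le_of_norm_le_one hT.le hK0 (norm_nonneg _) (norm_nonneg _) (norm_nonneg _)
      hM0 (by positivity) hy1 ?_ ?_ ?_
    · refine hu_le.trans ?_
      gcongr
      · linarith
      · nlinarith
    · refine hG.trans ((mul_le_of_le_one_right (by positivity) hw).trans ?_)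
      linarith
    · refine hs_le.trans ?_
      have hw2 : ‖w‖ ^ 2 ≤ 1 := pow_le_one₀ (norm_nonneg _) hw
      calc _ ≤ (m : ℝ) ^ 2 * ((T + 1) * (K + M)) := by
            gcongr ?_ * (?_ * ?_)
            · exact half_le_self (by positivity)
            · linarith
            · linarith
        _ = _ := by ring
  · right
    rw [← add_assoc (lamc T K ph ps g / N)]
    refine norm_add_add_le_mul_exp (inner_eq_sq_mul_alph hy1) ?_
    set r : ℝ := (√(N : ℝ))⁻¹ with hr
    have hsq : 1 ≤ √(N : ℝ) := one_le_sqrt.mpr hN1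
    have hr0 : 0 < r := by positivity
    have hr1 : r ≤ 1 := inv_le_one_of_one_le₀ hsq
    have hr2 : r ^ 2 = (N : ℝ)⁻¹ := by rw [hr, inv_pow, sq_sqrt (by positivity)]
    have hTN : T / N = T * r ^ 2 := by rw [hr2, div_eq_mul_inv]
    have hyc : ‖y‖ ^ c ≤ √(N : ℝ) := by
      calc ‖y‖ ^ c ≤ ((N : ℝ) ^ ((1 : ℝ) / (2 * c))) ^ c := by gcongr
        _ = √(N : ℝ) := by
          rw [← rpow_mul (by positivity), sqrt_eq_rpow]
          congr 1
          field_simp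
    have hlin : ∀ a : ℝ, 0 ≤ a → a ≤ a * ‖y‖ := fun a ha => le_mul_of_one_le_right ha hy1
    have hp0 := hlin _ (norm_nonneg (ph 0))
    have hq0 := hlin _ (norm_nonneg (ps 0))
    have hG0 := hlin _ (norm_nonneg (Gclm g 0))
    have hM1 := hlin _ hM0
    have hinner : ⟪y, u⟫ ≤ T / N * (‖y‖ ^ 2 * (K + ‖ph 0‖ + ‖ps 0‖)) := by
      refine inner_add_tamed_le hh0 ?_ ?_
      · have h1 := hOSL y 0
        rw [sub_zero, inner_sub_right] at h1
        have h2 := (real_inner_le_norm y (ph 0 + ps 0)).trans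
          (mul_le_mul_of_nonneg_left (norm_add_le _ _) (norm_nonneg y))
        nlinarith [norm_nonneg y]
      · have h2 := (real_inner_le_norm y (ph y)).trans
          (mul_le_mul_of_nonneg_left hph (norm_nonneg y))
        nlinarith [norm_nonneg y, norm_nonneg (ps 0), sq_nonneg ‖y‖,
          mul_nonneg (sq_nonneg ‖y‖) (norm_nonneg (ps 0))]
    have hu' : ‖u‖ ≤ ‖y‖ * (r * (T * (‖ph 0‖ + ‖ps 0‖ + 2 * K))) := by
      have h1 : ‖ph y‖ + ‖ps y‖ ≤ ‖y‖ * ((‖ph 0‖ + ‖ps 0‖ + 2 * K) * √(N : ℝ)) := by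
        have h2 : K * ‖y‖ ^ c * ‖y‖ ≤ K * √(N : ℝ) * ‖y‖ := by gcongr
        have h3 : (‖ph 0‖ + ‖ps 0‖ + K) * ‖y‖ ≤ (‖ph 0‖ + ‖ps 0‖ + K) * ‖y‖ * √(N : ℝ) :=
          le_mul_of_one_le_right (by positivity) hsq
        linarith
      refine hu_le.trans ((mul_le_mul_of_nonneg_left h1 hh0).trans_eq ?_)
      have h4 : r * √(N : ℝ) = 1 := inv_mul_cancel₀ (by positivity)
      rw [hTN]
      linear_combination (T * r * ‖y‖ * (‖ph 0‖ + ‖ps 0‖ + 2 * K)) * h4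
    have hG' : ‖Gclm g y w‖ ≤ ‖y‖ * ((‖Gclm g 0‖ + K) * ‖w‖) := by
      refine hG.trans ?_
      rw [← mul_assoc]
      gcongr
      linarith
    have hs' : ‖s‖ ≤ ‖y‖ * ((m : ℝ) ^ 2 * (K + M) / 2 * (‖w‖ + r * T)) := by
      have hw2 : ‖w‖ ^ 2 ≤ ‖w‖ := pow_le_of_le_one (norm_nonneg _) hw two_ne_zero
      have hrT : T / N ≤ r * T := by
        rw [hTN, mul_comm]
        gcongr
        exact pow_le_of_le_one hr0.le hr1 two_ne_zero
      calc ‖s‖ ≤ (m : ℝ) ^ 2 / 2 * ((‖w‖ + r * T) * (‖y‖ * (K + M))) := by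
            refine hs_le.trans ?_
            gcongr
            linarith
        _ = _ := by ring
    have hnorm : ‖u + (Gclm g y w + s)‖ ≤ ‖y‖ * (r * (T * (‖ph 0‖ + ‖ps 0‖ + 2 * K)) +
        ((‖Gclm g 0‖ + K) * ‖w‖ + (m : ℝ) ^ 2 * (K + M) / 2 * (‖w‖ + r * T))) := by
      rw [← add_assoc]
      refine norm_add₃_le.trans ?_
      linarith
    have hquad := lamc_quadratic_estimate (r := r) (ω := ‖w‖) hT.le hK0 (norm_nonneg (ph 0))
      (norm_nonneg (ps 0)) (norm_nonneg (Gclm g 0)) hM0 (sq_nonneg (m : ℝ))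
    have hsqn := pow_le_pow_left₀ (norm_nonneg _) hnorm 2
    rw [mul_pow] at hsqn
    have hmul := mul_le_mul_of_nonneg_left hquad (sq_nonneg ‖y‖)
    rw [hTN] at hinner
    rw [lamc, ← hM, div_eq_mul_inv, ← hr2]
    linarith

/-- Lemma 2.1 (pathwise domination), stated deterministically. -/
theorem semiTamedMilstein_pathwise_domination
    (d m N : ℕ) (hd : 0 < d) (hm : 0 < m) (hN : 0 < N)
    (T : ℝ) (hT : 0 < T)
    (ph ps : Vec d → Vec d) (g : Fin m → Vec d → Vec d)
    (K c : ℝ) (hK : 1 ≤ K) (hc : 1 ≤ c)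
    (hgdiff : ∀ j, ContDiff ℝ 1 (g j))
    (hOSL : ∀ x y : Vec d, ⟪x - y, (ph x + ps x) - (ph y + ps y)⟫ ≤ K * ‖x - y‖ ^ 2)
    (hgLip : ∀ x y : Vec d, ‖Gclm g x - Gclm g y‖ ≤ K * ‖x - y‖)
    (hphLip : ∀ x y : Vec d, ‖ph x - ph y‖ ≤ K * ‖x - y‖)
    (hpsC : ContDiff ℝ 1 ps)
    (hps' : ∀ x : Vec d, ‖fderiv ℝ ps x‖ ≤ K * ‖x‖ ^ c)
    (hLgLip : ∀ (j₁ j₂ : Fin m) (x y : Vec d), ‖Lg g j₁ j₂ x - Lg g j₁ j₂ y‖ ≤ K * ‖x - y‖)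
    (ξ : Vec d) (ΔW : ℕ → Vec m)
    (Y : ℕ → Vec d) (hY0 : Y 0 = ξ)
    (hYrec : ∀ n, Y (n + 1) = milstep (T / N) ph ps g (Y n) (ΔW n))
    (D : ℕ → ℝ)
    (hD : ∀ n, D n = Dproc (lamc T K ph ps g) ‖ξ‖ (fun k => ‖ΔW k‖ ^ 2)
        (fun k => alph (T / N) g (Y k) (ΔW k)) n)
    (n : ℕ) (hn : n ≤ N)
    (hDom : ∀ k < n, D k ≤ (N : ℝ) ^ ((1 : ℝ) / (2 * c)))
    (hWsmall : ∀ k < n, ‖ΔW k‖ ≤ 1) :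
    ‖Y n‖ ≤ D n := by
  have hlam : 0 ≤ lamc T K ph ps g := sq_nonneg _
  rw [hD]
  refine le_Dproc_of_step (r := fun k => ‖Y k‖) hN hn hlam (norm_nonneg ξ) (by rw [hY0]) ?_
  intro k hk hYk
  rw [← hD] at hYk
  simp only [hYrec]
  exact norm_milstep_le hN hT hK hc hOSL hgLip hphLip hpsC hps' hLgLip
    (hYk.trans (hDom k hk)) (hWsmall k hk)
end
end

section
/- Let λ > 0, p ≥ 1, T > 0, m ≥ 1 and N ∈ ℕ with N ≥ 4λpT. On a probability space let ΔW_0, …, ΔW_{N−1} : Ω → ℝ^m be mutually independent random vectors, each with law equal to the m-fold product of the real Gaussian measure with mean 0 and variance h = T/N. Then E[exp(pλ·Σ_{k=0}^{N−1} ‖ΔW_k‖²)] ≤ exp(2mpλT); in particular the supremum of these expectations over all N ≥ 4λpT is finite. (Lemma 2.2, with an explicit uniform bound.) -/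
open MeasureTheory ProbabilityTheory Real Finset
open scoped RealInnerProductSpace ENNReal NNReal

noncomputable section

/-- For a centred Gaussian of variance `v` and `4 * c * v ≤ 1`, the exponential moment of `c * x ^ 2`
is at most `exp (2 * c * v)`. -/
theorem lintegral_exp_mul_sq_gaussianReal_le {c : ℝ} {v : ℝ≥0} (hc : 0 ≤ c) (hv : v ≠ 0)
    (hcv : 4 * c * v ≤ 1) :
    ∫⁻ x, ENNReal.ofReal (Real.exp (c * x ^ 2)) ∂(gaussianReal 0 v)
      ≤ ENNReal.ofReal (Real.exp (2 * c * v)) := by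
  have hv0 : (0 : ℝ) < v := by positivity
  have hs : 0 < 1 - 2 * c * v := by linarith
  set w : ℝ≥0 := ⟨v / (1 - 2 * c * v), by positivity⟩
  have hwv : (w : ℝ) = v / (1 - 2 * c * v) := rfl
  have hw0 : w ≠ 0 := by
    rw [← NNReal.coe_ne_zero, hwv]
    positivity
  have hpdf : ∀ x, gaussianPDFReal 0 v x * Real.exp (c * x ^ 2)
      = (√(1 - 2 * c * v))⁻¹ * gaussianPDFReal 0 w x := by
    intro x
    rw [gaussianPDFReal, gaussianPDFReal, mul_assoc, ← Real.exp_add, ← mul_assoc, hwv]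
    congr 1
    · rw [← mul_inv, ← Real.sqrt_mul hs.le]
      congr 2
      rw [mul_left_comm, mul_div_cancel₀ _ hs.ne']
    · congr 1
      field_simp
      ring
  have hcoef : (√(1 - 2 * c * v))⁻¹ ≤ Real.exp (2 * c * v) := by
    rw [← Real.sqrt_inv, Real.sqrt_le_left (Real.exp_pos _).le, ← Real.exp_nat_mul,
      inv_le_iff_one_le_mul₀ hs]
    have hexp := Real.add_one_le_exp (((2 : ℕ) : ℝ) * (2 * c * v))
    have hcv0 : 0 ≤ c * v := by positivity
    push_cast at hexp ⊢
    nlinarith [mul_le_mul_of_nonneg_right hexp hs.le]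
  calc ∫⁻ x, ENNReal.ofReal (Real.exp (c * x ^ 2)) ∂(gaussianReal 0 v)
      = ∫⁻ x, gaussianPDF 0 v x * ENNReal.ofReal (Real.exp (c * x ^ 2)) := by
        rw [gaussianReal_of_var_ne_zero 0 hv,
          lintegral_withDensity_eq_lintegral_mul _ (measurable_gaussianPDF 0 v) (by fun_prop)]
        rfl
    _ = ∫⁻ x, ENNReal.ofReal (√(1 - 2 * c * v))⁻¹ * gaussianPDF 0 w x := by
        refine lintegral_congr fun x => ?_
        rw [gaussianPDF, gaussianPDF, ← ENNReal.ofReal_mul (gaussianPDFReal_nonneg _ _ _), hpdf,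
          ENNReal.ofReal_mul (by positivity)]
    _ = ENNReal.ofReal (√(1 - 2 * c * v))⁻¹ := by
        rw [lintegral_const_mul _ (measurable_gaussianPDF 0 w), lintegral_gaussianPDF_eq_one 0 hw0,
          mul_one]
    _ ≤ ENNReal.ofReal (Real.exp (2 * c * v)) := ENNReal.ofReal_le_ofReal hcoef

/-- For independent random variables, the exponential moment of a finite sum is the product of the
exponential moments. -/
theorem lintegral_exp_sum_eq_prod_of_iIndepFun {Ω ι : Type*} [Fintype ι] {mΩ : MeasurableSpace Ω}
    {P : Measure Ω} {X : ι → Ω → ℝ} (hX : ∀ i, Measurable (X i)) (hindep : iIndepFun X P) :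
    ∫⁻ ω, ENNReal.ofReal (Real.exp (∑ i, X i ω)) ∂P
      = ∏ i, ∫⁻ ω, ENNReal.ofReal (Real.exp (X i ω)) ∂P := by
  have hexp : Measurable fun x : ℝ => ENNReal.ofReal (Real.exp x) := by fun_prop
  rw [← lintegral_prod_eq_prod_lintegral_of_indepFun Finset.univ
    (fun i ω => ENNReal.ofReal (Real.exp (X i ω)))
    (hindep.comp (fun _ x => ENNReal.ofReal (Real.exp x)) fun _ => hexp)
    (fun i => hexp.comp (hX i))]
  refine lintegral_congr fun ω => ?_
  rw [Real.exp_sum, ENNReal.ofReal_prod_of_nonneg fun i _ => (Real.exp_pos _).le]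

/-- The exponential moment of `c * ‖x‖ ^ 2` under a centred Gaussian vector with independent
coordinates of variance `v`. -/
theorem lintegral_exp_mul_norm_sq_map_pi_gaussianReal_le {m : ℕ} {c : ℝ} {v : ℝ≥0} (hc : 0 ≤ c)
    (hv : v ≠ 0) (hcv : 4 * c * v ≤ 1) :
    ∫⁻ x : Vec m, ENNReal.ofReal (Real.exp (c * ‖x‖ ^ 2))
        ∂(Measure.map (WithLp.toLp 2) (Measure.pi fun _ : Fin m => gaussianReal 0 v))
      ≤ ENNReal.ofReal (Real.exp (2 * c * v)) ^ m := by
  rw [lintegral_map (by fun_prop) (by fun_prop)]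
  simp only [EuclideanSpace.real_norm_sq_eq, Finset.mul_sum]
  rw [lintegral_exp_sum_eq_prod_of_iIndepFun
    (X := fun (i : Fin m) (x : Fin m → ℝ) => c * x i ^ 2) (fun i => by fun_prop)
    (iIndepFun_pi (X := fun (_ : Fin m) (y : ℝ) => c * y ^ 2) fun i => by fun_prop)]
  refine (Finset.prod_le_pow_card _ _ (ENNReal.ofReal (Real.exp (2 * c * v)))
    fun i _ => ?_).trans_eq (by simp)
  rw [(measurePreserving_eval (fun _ : Fin m => gaussianReal 0 v) i).lintegral_comp
    (f := fun y => ENNReal.ofReal (Real.exp (c * y ^ 2))) (by fun_prop)]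
  exact lintegral_exp_mul_sq_gaussianReal_le hc hv hcv

/-- Lemma 2.2 with an explicit uniform bound: for N ≥ 4 λ p T,
E[exp(p λ Σ_k ‖ΔW_k‖²)] ≤ exp(2 m p λ T). -/
theorem exp_moment_sum_sq_increments
    (m N : ℕ) (hm : 0 < m)
    (lam p T : ℝ) (hlam : 0 < lam) (hp : 1 ≤ p) (hT : 0 < T)
    (hN : 4 * lam * p * T ≤ (N : ℝ))
    (Ω : Type) (mΩ : MeasurableSpace Ω) (P : Measure Ω) (hP : IsProbabilityMeasure P)
    (ΔW : Fin N → Ω → Vec m)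
    (hmeas : ∀ k, Measurable (ΔW k))
    (hlaw : ∀ k, Measure.map (ΔW k) P
      = Measure.map (WithLp.toLp 2)
          (Measure.pi (fun _ : Fin m => gaussianReal 0 (Real.toNNReal (T / N)))))
    (hindep : iIndepFun ΔW P) :
    ∫⁻ ω, ENNReal.ofReal (Real.exp (p * lam * ∑ k, ‖ΔW k ω‖ ^ 2)) ∂P
      ≤ ENNReal.ofReal (Real.exp (2 * m * p * lam * T)) := by
  have hpl : 0 < p * lam := by positivity
  have hN0 : (0 : ℝ) < N := lt_of_lt_of_le (by positivity) hN
  have hv : ((T / N).toNNReal : ℝ) = T / N := Real.coe_toNNReal _ (by positivity)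
  have hv0 : (T / N).toNNReal ≠ 0 := by
    rw [← NNReal.coe_ne_zero, hv]
    positivity
  have hcv : 4 * (p * lam) * ((T / N).toNNReal : ℝ) ≤ 1 := by
    rw [hv, ← mul_div_assoc, div_le_one hN0]
    linarith
  have hsq : Measurable fun x : Vec m => p * lam * ‖x‖ ^ 2 := by fun_prop
  simp only [Finset.mul_sum]
  rw [lintegral_exp_sum_eq_prod_of_iIndepFun
    (X := fun k ω => p * lam * ‖ΔW k ω‖ ^ 2) (fun k => hsq.comp (hmeas k))
    (hindep.comp (fun _ x => p * lam * ‖x‖ ^ 2) fun _ => hsq)]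
  refine (Finset.prod_le_pow_card _ _ (ENNReal.ofReal (Real.exp (2 * (p * lam) * (T / N))) ^ m)
    fun k _ => ?_).trans_eq ?_
  · rw [← lintegral_map (f := fun x : Vec m => ENNReal.ofReal (Real.exp (p * lam * ‖x‖ ^ 2)))
      (by fun_prop) (hmeas k), hlaw k]
    simpa only [hv] using lintegral_exp_mul_norm_sq_map_pi_gaussianReal_le hpl.le hv0 hcv
  · rw [Finset.card_univ, Fintype.card_fin, ← pow_mul, ← ENNReal.ofReal_pow (Real.exp_pos _).le,
      ← Real.exp_nat_mul]
    congr 2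
    push_cast
    field_simp
end
end

section
/- Under Assumption 2.1 and the probabilistic setup below, for each p ≥ 1 there is a finite constant B (depending only on p, d, m, T, K, c, ϕ, φ, g and the law of ξ, but not on N) such that for every N ∈ ℕ with N ≥ 8λpT: E[sup_{0≤n≤N} |D_n|^p] ≤ B. (Lemma 2.4.) -/
open MeasureTheory ProbabilityTheory Real Finset
open scoped RealInnerProductSpace ENNReal NNReal

noncomputable section

theorem lintegral_exp_quadratic_gaussianReal_le {b h : ℝ} (v : ℝ) (hb : 0 ≤ b) (hh : 0 < h)
    (hbh : b * h ≤ 27 / 64) :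
    ∫⁻ x, ENNReal.ofReal (exp (b * x ^ 2 + v * x)) ∂(gaussianReal 0 h.toNNReal)
      ≤ ENNReal.ofReal (exp (7 * b * h + 4 * v ^ 2 * h)) := by
  have hδ : 0 < 1 - 2 * b * h := by linarith
  set δ := 1 - 2 * b * h with hδdef
  set s := h / δ with hs
  have hs0 : 0 < s := by positivity
  have hne : h.toNNReal ≠ 0 := by simpa using hh
  have hsne : s.toNNReal ≠ 0 := by simpa using hs0
  have key : ∀ x, gaussianPDFReal 0 h.toNNReal x * exp (b * x ^ 2 + v * x)
      = (√(δ⁻¹) * exp (v ^ 2 * s / 2)) * gaussianPDFReal (v * s) s.toNNReal x := by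
    intro x
    simp only [gaussianPDFReal, Real.coe_toNNReal _ hh.le, Real.coe_toNNReal _ hs0.le]
    have h1 : (√(2 * π * h))⁻¹ = √(δ⁻¹) * (√(2 * π * s))⁻¹ := by
      rw [← Real.sqrt_inv, ← Real.sqrt_inv, ← Real.sqrt_mul (by positivity)]
      congr 1
      rw [hs]; field_simp
    have h2 : -(x - 0) ^ 2 / (2 * h) + (b * x ^ 2 + v * x)
        = v ^ 2 * s / 2 + -(x - v * s) ^ 2 / (2 * s) := by
      rw [hs]; field_simp; rw [hδdef]; ring
    rw [h1, mul_assoc, ← Real.exp_add, h2, Real.exp_add]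
    ring
  have hle : √(δ⁻¹) * exp (v ^ 2 * s / 2) ≤ exp (7 * b * h + 4 * v ^ 2 * h) := by
    have hi : δ⁻¹ ≤ 7 := by
      rw [inv_le_comm₀ hδ (by norm_num)]; linarith
    have h1 : δ⁻¹ ≤ exp (14 * b * h) := by
      have : δ⁻¹ = 1 + 2 * (b * h) * δ⁻¹ := by field_simp; linarith
      have h2 : 2 * (b * h) * δ⁻¹ ≤ 2 * (b * h) * 7 := by gcongr
      have := Real.add_one_le_exp (14 * b * h)
      linarith
    have h2 : √(δ⁻¹) ≤ exp (7 * b * h) := by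
      rw [Real.sqrt_le_left (exp_pos _).le, ← Real.exp_nat_mul]
      convert h1 using 2; push_cast; ring
    have h3 : v ^ 2 * s / 2 ≤ 4 * v ^ 2 * h := by
      have : s ≤ h * 7 := by rw [hs, div_eq_mul_inv]; gcongr
      nlinarith [sq_nonneg v, mul_nonneg (sq_nonneg v) hh.le]
    rw [Real.exp_add]
    gcongr
  rw [gaussianReal_of_var_ne_zero 0 hne,
    lintegral_withDensity_eq_lintegral_mul _ (measurable_gaussianPDF _ _) (by fun_prop)]
  calc _ = ∫⁻ x, ENNReal.ofReal (√(δ⁻¹) * exp (v ^ 2 * s / 2))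
        * ENNReal.ofReal (gaussianPDFReal (v * s) s.toNNReal x) := by
        refine lintegral_congr fun x => ?_
        rw [Pi.mul_apply, gaussianPDF, ← ENNReal.ofReal_mul (gaussianPDFReal_nonneg _ _ _), key,
          ENNReal.ofReal_mul (by positivity)]
    _ = ENNReal.ofReal (√(δ⁻¹) * exp (v ^ 2 * s / 2)) := by
        rw [lintegral_const_mul _ (by fun_prop), lintegral_gaussianPDFReal_eq_one _ hsne, mul_one]
    _ ≤ _ := ENNReal.ofReal_le_ofReal hle

/-- The law of a vector of `m` independent centred Gaussians with variance `h`. -/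
def gaussianVec (m : ℕ) (h : ℝ) : Measure (Vec m) :=
  Measure.map (WithLp.toLp 2) (Measure.pi fun _ : Fin m => gaussianReal 0 h.toNNReal)

theorem lintegral_exp_quadratic_gaussianVec_le {m : ℕ} {b h V : ℝ} (v : Vec m) (hb : 0 ≤ b)
    (hh : 0 < h) (hbh : b * h ≤ 27 / 64) (hv : ‖v‖ ≤ V) :
    ∫⁻ w, ENNReal.ofReal (exp (b * ‖w‖ ^ 2 + ⟪v, w⟫)) ∂(gaussianVec m h)
      ≤ ENNReal.ofReal (exp ((7 * m * b + 4 * V ^ 2) * h)) := by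
  rw [gaussianVec, lintegral_map (by fun_prop) (by fun_prop)]
  have hprod : ∀ x : Fin m → ℝ,
      ENNReal.ofReal (exp (b * ‖WithLp.toLp 2 x‖ ^ 2 + ⟪v, WithLp.toLp 2 x⟫))
        = ∏ i, ENNReal.ofReal (exp (b * x i ^ 2 + v i * x i)) := by
    intro x
    rw [← ENNReal.ofReal_prod_of_nonneg fun _ _ => (exp_pos _).le, ← Real.exp_sum,
      Finset.sum_add_distrib, ← Finset.mul_sum, EuclideanSpace.real_norm_sq_eq, PiLp.inner_apply]
    simp [mul_comm]
  have hind := iIndepFun_pi (μ := fun _ : Fin m => gaussianReal 0 h.toNNReal)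
    (X := fun i x => ENNReal.ofReal (exp (b * x ^ 2 + v i * x)))
    (fun i => by fun_prop)
  simp_rw [hprod]
  rw [lintegral_prod_eq_prod_lintegral_of_indepFun Finset.univ _ hind (fun i => by fun_prop)]
  calc _ ≤ ∏ i : Fin m, ENNReal.ofReal (exp (7 * b * h + 4 * v i ^ 2 * h)) := by
        refine Finset.prod_le_prod' fun i _ => ?_
        rw [(measurePreserving_eval (fun _ : Fin m => gaussianReal 0 h.toNNReal) i).lintegral_comp
          (f := fun x => ENNReal.ofReal (exp (b * x ^ 2 + v i * x))) (by fun_prop)]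
        exact lintegral_exp_quadratic_gaussianReal_le _ hb hh hbh
    _ ≤ _ := by
        rw [← ENNReal.ofReal_prod_of_nonneg fun _ _ => (exp_pos _).le, ← Real.exp_sum]
        refine ENNReal.ofReal_le_ofReal (exp_le_exp.2 ?_)
        have : ∑ i, v i ^ 2 ≤ V ^ 2 := by
          rw [← EuclideanSpace.real_norm_sq_eq]; gcongr
        have hsum : ∑ i : Fin m, (7 * b * h + 4 * v i ^ 2 * h)
            = 7 * m * b * h + 4 * (∑ i, v i ^ 2) * h := by
          rw [Finset.sum_add_distrib, ← Finset.sum_mul, Finset.mul_sum]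
          simp only [Finset.sum_const, Finset.card_univ, Fintype.card_fin, nsmul_eq_mul,
            Finset.sum_mul]
          ring
        rw [hsum, add_mul]
        gcongr

section Independence

variable {Ω α β γ : Type*} [MeasurableSpace Ω] [MeasurableSpace α] [MeasurableSpace β]
  [MeasurableSpace γ] {P : Measure Ω} [IsProbabilityMeasure P]

theorem indepFun_prodMk_left_of_indepFun {X : Ω → α} {A : Ω → β} {B : Ω → γ}
    (hX : Measurable X) (hA : Measurable A) (hB : Measurable B)
    (hXAB : IndepFun X (fun ω => (A ω, B ω)) P) (hAB : IndepFun A B P) :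
    IndepFun (fun ω => (X ω, A ω)) B P := by
  have hXA : IndepFun X A P := hXAB.comp measurable_id measurable_fst
  rw [indepFun_iff_map_prod_eq_prod_map_map (by fun_prop) (by fun_prop)] at hXAB hAB hXA ⊢
  have := Measure.isProbabilityMeasure_map (μ := P) hX.aemeasurable
  have := Measure.isProbabilityMeasure_map (μ := P) hA.aemeasurable
  have := Measure.isProbabilityMeasure_map (μ := P) hB.aemeasurable
  apply MeasurableEquiv.prodAssoc.map_measurableEquiv_injective
  rw [hXA, Measure.prodAssoc_prod, ← hAB, ← hXAB, Measure.map_map (by fun_prop) (by fun_prop)]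
  rfl

variable {ξ : Ω → α} {W : ℕ → Ω → β}

theorem indepFun_past_increment (hξ : Measurable ξ) (hW : ∀ k, Measurable (W k))
    (hind : iIndepFun W P) (hξW : IndepFun ξ (fun ω k => W k ω) P) (n : ℕ) :
    IndepFun (fun ω => (ξ ω, fun k : Finset.range n => W k ω)) (W n) P := by
  refine indepFun_prodMk_left_of_indepFun hξ (by fun_prop) (hW n) ?_ ?_
  · exact hξW.comp measurable_id
      (ψ := fun w : ℕ → β => ((fun k : Finset.range n => w k), w n)) (by fun_prop)
  · have := hind.indepFun_finset (Finset.range n) {n} (by simp) hW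
    exact this.comp measurable_id
      (ψ := fun w : ({n} : Finset ℕ) → β => w ⟨n, by simp⟩) (by fun_prop)

/-- A Markov recursion driven by independent increments is independent of the next increment. -/
theorem indepFun_recursion_increment {Z : ℕ → Ω → γ} {ι : α → γ} {Φ : γ × β → γ}
    (hξ : Measurable ξ) (hW : ∀ k, Measurable (W k))
    (hind : iIndepFun W P) (hξW : IndepFun ξ (fun ω k => W k ω) P)
    (hι : Measurable ι) (hΦ : Measurable Φ) (hZ0 : ∀ ω, Z 0 ω = ι (ξ ω))
    (hZ : ∀ n ω, Z (n + 1) ω = Φ (Z n ω, W n ω)) (n : ℕ) : IndepFun (Z n) (W n) P := by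
  have hrep : ∀ n, ∃ Ψ : α × (Finset.range n → β) → γ, Measurable Ψ ∧
      ∀ ω, Z n ω = Ψ (ξ ω, fun k => W k ω) := by
    intro n
    induction n with
    | zero => exact ⟨fun x => ι x.1, by fun_prop, hZ0⟩
    | succ n ih =>
      obtain ⟨Ψ, hΨ, hΨZ⟩ := ih
      have hlt : ∀ k : Finset.range n, (k : ℕ) ∈ Finset.range (n + 1) := fun k =>
        Finset.mem_range.2 (by have := Finset.mem_range.1 k.2; omega)
      refine ⟨fun x => Φ (Ψ (x.1, fun k => x.2 ⟨k, hlt k⟩), x.2 ⟨n, by simp⟩), ?_, ?_⟩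
      · refine hΦ.comp (Measurable.prodMk (hΨ.comp (measurable_fst.prodMk ?_)) ?_)
        · exact measurable_pi_lambda _ fun k => (measurable_pi_apply _).comp measurable_snd
        · exact (measurable_pi_apply _).comp measurable_snd
      · intro ω
        rw [hZ, hΨZ]
  obtain ⟨Ψ, hΨ, hΨZ⟩ := hrep n
  rw [funext hΨZ]
  exact (indepFun_past_increment hξ hW hind hξW n).comp hΨ measurable_id

theorem lintegral_recursion_le {Z : ℕ → Ω → γ} {ι : α → γ} {Φ : γ × β → γ} {ν : Measure β}
    {V : γ → ℝ≥0∞} (hξ : Measurable ξ) (hW : ∀ k, Measurable (W k))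
    (hlaw : ∀ k, Measure.map (W k) P = ν)
    (hind : iIndepFun W P) (hξW : IndepFun ξ (fun ω k => W k ω) P)
    (hι : Measurable ι) (hΦ : Measurable Φ) (hZ0 : ∀ ω, Z 0 ω = ι (ξ ω))
    (hZ : ∀ n ω, Z (n + 1) ω = Φ (Z n ω, W n ω)) (hV : Measurable V)
    (hdrift : ∀ z, ∫⁻ w, V (Φ (z, w)) ∂ν ≤ V z) (n : ℕ) :
    ∫⁻ ω, V (Z n ω) ∂P ≤ ∫⁻ ω, V (ι (ξ ω)) ∂P := by
  have hZm : ∀ n, Measurable (Z n) := by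
    intro n
    induction n with
    | zero => rw [funext hZ0]; fun_prop
    | succ n ih => rw [funext (hZ n)]; fun_prop
  induction n with
  | zero => simp_rw [hZ0]; rfl
  | succ n ih =>
    refine le_trans ?_ ih
    have hI := indepFun_recursion_increment hξ hW hind hξW hι hΦ hZ0 hZ n
    rw [indepFun_iff_map_prod_eq_prod_map_map (hZm n).aemeasurable (hW n).aemeasurable,
      hlaw n] at hI
    have : IsProbabilityMeasure ν :=
      hlaw n ▸ Measure.isProbabilityMeasure_map (hW n).aemeasurable
    calc ∫⁻ ω, V (Z (n + 1) ω) ∂P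
        = ∫⁻ q, V (Φ q) ∂(Measure.map (fun ω => (Z n ω, W n ω)) P) := by
          rw [lintegral_map (by fun_prop) ((hZm n).prodMk (hW n))]
          simp_rw [hZ]
      _ = ∫⁻ z, ∫⁻ w, V (Φ (z, w)) ∂ν ∂(Measure.map (Z n) P) := by
          rw [hI, lintegral_prod _ (by fun_prop)]
      _ ≤ ∫⁻ z, V z ∂(Measure.map (Z n) P) := lintegral_mono hdrift
      _ = ∫⁻ ω, V (Z n ω) ∂P := lintegral_map hV (hZm n)

/-- Moment bound for the running maximum of an exponential supermartingale, at half the exponent. -/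
theorem lintegral_exp_half_partialSups_le {Y : ℕ → Ω → γ} {ι : α → γ} {F : γ × β → γ}
    {e : γ × β → ℝ} {ν : Measure β} {G : α → ℝ≥0∞}
    (hξ : Measurable ξ) (hW : ∀ k, Measurable (W k)) (hlaw : ∀ k, Measure.map (W k) P = ν)
    (hind : iIndepFun W P) (hξW : IndepFun ξ (fun ω k => W k ω) P)
    (hι : Measurable ι) (hF : Measurable F) (hY0 : ∀ ω, Y 0 ω = ι (ξ ω))
    (hY : ∀ n ω, Y (n + 1) ω = F (Y n ω, W n ω)) (he : Measurable e) (hG : Measurable G)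
    (hle : ∀ y, ∫⁻ w, ENNReal.ofReal (exp (e (y, w))) ∂ν ≤ 1) (n : ℕ) :
    ∫⁻ ω, G (ξ ω) * ENNReal.ofReal
        (exp (partialSups (fun j => ∑ k ∈ Finset.range j, e (Y k ω, W k ω)) n / 2)) ∂P
      ≤ 2 * ∫⁻ ω, G (ξ ω) ∂P := by
  have hν : IsProbabilityMeasure ν :=
    hlaw 0 ▸ Measure.isProbabilityMeasure_map (hW 0).aemeasurable
  let V : α × γ × ℝ × ℝ → ℝ≥0∞ := fun z =>
    G z.1 * (ENNReal.ofReal (exp (z.2.2.2 / 2))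
      + ENNReal.ofReal (exp (z.2.2.1 - z.2.2.2 / 2)))
  let Φ : (α × γ × ℝ × ℝ) × β → α × γ × ℝ × ℝ := fun q =>
    (q.1.1, F (q.1.2.1, q.2), q.1.2.2.1 + e (q.1.2.1, q.2),
      max q.1.2.2.2 (q.1.2.2.1 + e (q.1.2.1, q.2)))
  have hV : Measurable V := by fun_prop
  have hΦ : Measurable Φ := by fun_prop
  have hpt : ∀ L r : ℝ,
      exp (max r L / 2) + exp (L - max r L / 2) ≤ exp (r / 2) + exp (L - r / 2) := by
    intro L r
    rcases le_total L r with h | h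
    · rw [max_eq_left h]
    · rw [max_eq_right h]
      have h1 : exp (L / 2) = exp (r / 4) * exp (L / 2 - r / 4) := by
        rw [← Real.exp_add]; ring_nf
      have h2 : exp (r / 2) = exp (r / 4) ^ 2 := by rw [← Real.exp_nat_mul]; push_cast; ring_nf
      have h3 : exp (L - r / 2) = exp (L / 2 - r / 4) ^ 2 := by
        rw [← Real.exp_nat_mul]; push_cast; ring_nf
      have h4 : L - L / 2 = L / 2 := by ring
      rw [h4, h1, h2, h3]
      nlinarith [sq_nonneg (exp (r / 4) - exp (L / 2 - r / 4))]
  have hdrift : ∀ z, ∫⁻ w, V (Φ (z, w)) ∂ν ≤ V z := by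
    rintro ⟨x, y, L, r⟩
    have hb : ∀ w, V (Φ ((x, y, L, r), w)) ≤ G x * (ENNReal.ofReal (exp (r / 2))
        + ENNReal.ofReal (exp (L - r / 2)) * ENNReal.ofReal (exp (e (y, w)))) := by
      intro w
      have := hpt (L + e (y, w)) r
      simp only [V, Φ]
      rw [← ENNReal.ofReal_mul (exp_pos _).le, ← Real.exp_add,
        ← ENNReal.ofReal_add (exp_pos _).le (exp_pos _).le,
        ← ENNReal.ofReal_add (exp_pos _).le (exp_pos _).le]
      rw [sub_add_eq_add_sub]
      exact mul_le_mul_right (ENNReal.ofReal_le_ofReal this) _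
    calc _ ≤ ∫⁻ w, G x * (ENNReal.ofReal (exp (r / 2))
          + ENNReal.ofReal (exp (L - r / 2)) * ENNReal.ofReal (exp (e (y, w)))) ∂ν :=
          lintegral_mono hb
      _ = G x * (ENNReal.ofReal (exp (r / 2)) + ENNReal.ofReal (exp (L - r / 2))
          * ∫⁻ w, ENNReal.ofReal (exp (e (y, w))) ∂ν) := by
          rw [lintegral_const_mul _ (by fun_prop), lintegral_add_left (by fun_prop),
            lintegral_const_mul _ (by fun_prop)]
          simp
      _ ≤ G x * (ENNReal.ofReal (exp (r / 2)) + ENNReal.ofReal (exp (L - r / 2)) * 1) := by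
          gcongr
          exact hle y
      _ = V (x, y, L, r) := by simp [V]
  have main := lintegral_recursion_le (V := V) (Φ := Φ) (ι := fun x => (x, ι x, 0, 0))
    (Z := fun n ω => (ξ ω, Y n ω, ∑ k ∈ Finset.range n, e (Y k ω, W k ω),
      partialSups (fun j => ∑ k ∈ Finset.range j, e (Y k ω, W k ω)) n))
    hξ hW hlaw hind hξW (by fun_prop) hΦ (by intro ω; simp [hY0])
    (by
      intro n ω
      simp only [Φ, hY, partialSups_add_one, Finset.sum_range_succ]) hV hdrift n
  calc _ ≤ _ := lintegral_mono fun ω => by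
        simp only [V]
        gcongr
        exact le_self_add
    _ ≤ _ := main
    _ = _ := by
        simp only [V]
        rw [← lintegral_const_mul _ (by fun_prop)]
        refine lintegral_congr fun ω => ?_
        norm_num
        rw [mul_comm]

end Independence

theorem lintegral_exp_gaussianVec_le_one {m : ℕ} {b c h V : ℝ} {v : Vec m} {e : Vec m → ℝ}
    (hb : 0 ≤ b) (hh : 0 < h) (hbh : b * h ≤ 27 / 64) (hv : ‖v‖ ≤ V)
    (he : ∀ w, e w ≤ b * ‖w‖ ^ 2 + ⟪v, w⟫ + c * h - (7 * m * b + 4 * V ^ 2 + c) * h) :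
    ∫⁻ w, ENNReal.ofReal (exp (e w)) ∂(gaussianVec m h) ≤ 1 := by
  set A := (7 * m * b + 4 * V ^ 2) * h with hA
  calc _ ≤ ∫⁻ w, ENNReal.ofReal (exp (-A)) * ENNReal.ofReal (exp (b * ‖w‖ ^ 2 + ⟪v, w⟫))
        ∂(gaussianVec m h) := by
        refine lintegral_mono fun w => ?_
        rw [← ENNReal.ofReal_mul (exp_pos _).le, ← Real.exp_add]
        refine ENNReal.ofReal_le_ofReal (exp_le_exp.2 ((he w).trans (le_of_eq ?_)))
        rw [hA]; ring
    _ ≤ ENNReal.ofReal (exp (-A)) * ENNReal.ofReal (exp A) := by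
        rw [lintegral_const_mul _ (by fun_prop)]
        gcongr
        exact lintegral_exp_quadratic_gaussianVec_le v hb hh hbh hv
    _ = 1 := by
        rw [← ENNReal.ofReal_mul (exp_pos _).le, ← Real.exp_add]
        simp

section Coefficients

variable {d m : ℕ} {g : Fin m → Vec d → Vec d} {K : ℝ}

theorem Gclm_apply (x : Vec d) (w : Vec m) : Gclm g x w = ∑ j, w j • g j x := rfl

theorem norm_sum_milstein_le {C h : ℝ} (w : Vec m) (L : Fin m → Fin m → Vec d) (hh : 0 ≤ h)
    (hL : ∀ i j, ‖L i j‖ ≤ C) (hC : 0 ≤ C) :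
    ‖∑ i, ∑ j, (w i * w j - (if i = j then h else 0)) • L i j‖ ≤ m * C * (‖w‖ ^ 2 + h) := by
  have hij : ∀ i j, ‖(w i * w j - (if i = j then h else 0)) • L i j‖
      ≤ (|w i| * |w j| + if i = j then h else 0) * C := by
    intro i j
    rw [norm_smul, Real.norm_eq_abs]
    gcongr
    · refine (abs_sub _ _).trans ?_
      rw [abs_mul]
      gcongr
      split_ifs <;> simp [abs_of_nonneg hh]
    · exact hL i j
  calc _ ≤ ∑ i, ∑ j, (|w i| * |w j| + if i = j then h else 0) * C :=
        norm_sum_le_of_le _ fun i _ => norm_sum_le_of_le _ fun j _ => hij i j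
    _ = ((∑ i, |w i|) ^ 2 + m * h) * C := by
        simp_rw [← Finset.sum_mul, Finset.sum_add_distrib]
        simp [sq, Finset.sum_mul_sum]
    _ ≤ (m * ‖w‖ ^ 2 + m * h) * C := by
        gcongr
        have := sq_sum_le_card_mul_sum_sq (s := Finset.univ) (f := fun i => |w i|)
        simpa [EuclideanSpace.real_norm_sq_eq] using this
    _ = _ := by ring

/-- `alph` is linear in the increment up to a quadratic remainder, uniformly in the state. -/
theorem exists_abs_alph_sub_inner_le {C h : ℝ} (hK : 0 ≤ K) (hh : 0 ≤ h)
    (hgLip : ∀ x y : Vec d, ‖Gclm g x - Gclm g y‖ ≤ K * ‖x - y‖)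
    (hLg : ∀ i j y, ‖Lg g i j y‖ ≤ K * ‖y‖ + C) (hC : 0 ≤ C) (y : Vec d) :
    ∃ v : Vec m, ‖v‖ ≤ K + ‖Gclm g 0‖ ∧
      ∀ w, |alph h g y w - ⟪v, w⟫| ≤ m * (K + C) / 2 * (‖w‖ ^ 2 + h) := by
  by_cases hy : 1 ≤ ‖y‖
  swap
  · refine ⟨0, by simp; positivity, fun w => ?_⟩
    simp only [alph, hy, if_false, inner_zero_left, sub_zero, abs_zero]
    positivity
  have hy0 : 0 < ‖y‖ := by linarith
  have hu : ‖‖y‖⁻¹ • y‖ = 1 := by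
    rw [norm_smul, norm_inv, norm_norm, inv_mul_cancel₀ hy0.ne']
  refine ⟨(Gclm g y).adjoint (‖y‖⁻¹ • ‖y‖⁻¹ • y), ?_, fun w => ?_⟩
  · calc _ ≤ ‖(Gclm g y).adjoint‖ * ‖‖y‖⁻¹ • ‖y‖⁻¹ • y‖ := ContinuousLinearMap.le_opNorm _ _
      _ = ‖Gclm g y‖ * ‖y‖⁻¹ := by
          rw [norm_smul, hu, mul_one, norm_inv, norm_norm, LinearIsometryEquiv.norm_map]
      _ ≤ ((K + ‖Gclm g 0‖) * ‖y‖) * ‖y‖⁻¹ := by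
          gcongr
          have h1 := hgLip y 0
          have h2 := norm_le_norm_sub_add (Gclm g y) (Gclm g 0)
          rw [sub_zero] at h1
          nlinarith [norm_nonneg (Gclm g 0)]
      _ = _ := by field_simp
  · simp only [alph, hy, if_true]
    rw [ContinuousLinearMap.adjoint_inner_left, real_inner_smul_left (‖y‖⁻¹ • y),
      real_inner_smul_right, add_sub_cancel_left]
    refine (abs_real_inner_le_norm _ _).trans ?_
    rw [hu, one_mul, norm_smul, norm_inv, norm_mul, norm_norm, Real.norm_two]
    have := norm_sum_milstein_le w (fun i j => Lg g i j y) hh (C := (K + C) * ‖y‖)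
      (fun i j => (hLg i j y).trans (by nlinarith)) (by positivity)
    calc _ ≤ (2 * ‖y‖)⁻¹ * (m * ((K + C) * ‖y‖) * (‖w‖ ^ 2 + h)) := by gcongr
      _ = _ := by field_simp

theorem measurable_milstep {h : ℝ} {ph ps : Vec d → Vec d} (hph : Measurable ph)
    (hps : Measurable ps) (hg : ∀ j, Measurable (g j)) (hL : ∀ i j, Measurable (Lg g i j)) :
    Measurable fun q : Vec d × Vec m => milstep h ph ps g q.1 q.2 := by
  simp only [milstep, Gclm_apply]
  fun_prop

theorem measurable_alph {h : ℝ} (hg : ∀ j, Measurable (g j)) (hL : ∀ i j, Measurable (Lg g i j)) :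
    Measurable fun q : Vec d × Vec m => alph h g q.1 q.2 := by
  simp only [alph, Gclm_apply]
  refine Measurable.ite (measurableSet_le measurable_const (by fun_prop)) ?_ measurable_const
  fun_prop

end Coefficients

theorem lintegral_add_norm_rpow_lt_top {d : ℕ} {μ : Measure (Vec d)} [IsProbabilityMeasure μ]
    (hμ : ∀ r : ℕ, Integrable (fun x => ‖x‖ ^ r) μ) {a p : ℝ} (ha : 1 ≤ a) :
    ∫⁻ x, ENNReal.ofReal ((a + ‖x‖) ^ p) ∂μ < ∞ := by
  obtain ⟨r, hr⟩ := exists_nat_ge p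
  have hint : Integrable (fun x : Vec d => 2 ^ (r - 1) * (a ^ r + ‖x‖ ^ r)) μ :=
    ((integrable_const _).add (hμ r)).const_mul _
  refine lt_of_le_of_lt (lintegral_mono fun x => ENNReal.ofReal_le_ofReal ?_) hint.lintegral_lt_top
  calc (a + ‖x‖) ^ p ≤ (a + ‖x‖) ^ (r : ℝ) :=
        Real.rpow_le_rpow_of_exponent_le (by linarith [norm_nonneg x]) hr
    _ = (a + ‖x‖) ^ r := Real.rpow_natCast _ _
    _ ≤ _ := add_pow_le (by linarith) (norm_nonneg x) r

/-- The running maximum over windows is controlled by two running maxima from the origin. -/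
theorem sup'_abs_Dproc_rpow_le {lam x p c rA rB : ℝ} {w2 al : ℕ → ℝ} {N : ℕ}
    (hlam : 0 ≤ lam) (hx : 0 ≤ x) (hp : 0 ≤ p) (hw2 : ∀ k, 0 ≤ w2 k)
    (hA : ∀ n ≤ N, 3 * p * ∑ k ∈ Finset.range n, (lam * w2 k + al k) ≤ rA + c)
    (hB : ∀ n ≤ N, 6 * p * ∑ k ∈ Finset.range n, -al k ≤ rB + c) :
    (Finset.range (N + 1)).sup' Finset.nonempty_range_add_one
        (fun n => |Dproc lam x w2 al n| ^ p)
      ≤ exp (p * lam + c / 2) * ((lam + x) ^ p * (exp (rA / 2) + exp (rB / 2))) := by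
  refine Finset.sup'_le _ _ fun n hn => ?_
  have hnN : n ≤ N := by have := Finset.mem_range.1 hn; omega
  rw [Dproc, abs_of_nonneg (by positivity), Real.mul_rpow (by positivity) (exp_pos _).le,
    ← Real.exp_mul, mul_left_comm]
  gcongr
  set S := (Finset.range (n + 1)).sup' Finset.nonempty_range_add_one
    (fun u => ∑ k ∈ Finset.Ico u n, (lam * w2 k + al k)) with hS
  have hpS : p * S ≤ (rA + c) / 3 + (rB + c) / 6 := by
    obtain ⟨u, hu, hSu⟩ := Finset.exists_mem_eq_sup' Finset.nonempty_range_add_one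
      (fun u => ∑ k ∈ Finset.Ico u n, (lam * w2 k + al k)) (s := Finset.range (n + 1))
    have hun : u ≤ n := by have := Finset.mem_range.1 hu; omega
    rw [hS, hSu, Finset.sum_Ico_eq_sub _ hun]
    have h1 := hA n hnN
    have h2 := hB u (hun.trans hnN)
    have h3 : 0 ≤ p * ∑ k ∈ Finset.range u, lam * w2 k :=
      mul_nonneg hp (Finset.sum_nonneg fun k _ => mul_nonneg hlam (hw2 k))
    rw [Finset.sum_neg_distrib] at h2
    rw [Finset.sum_add_distrib (s := Finset.range u)]
    nlinarith
  calc exp ((lam + S) * p) ≤ exp ((p * lam + c / 2) + max (rA / 2) (rB / 2)) := by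
        refine exp_le_exp.2 ?_
        nlinarith [le_max_left (rA / 2) (rB / 2), le_max_right (rA / 2) (rB / 2)]
    _ ≤ _ := by
        rw [Real.exp_add]
        gcongr
        rcases max_choice (rA / 2) (rB / 2) with h | h <;> rw [h] <;>
          linarith [exp_pos (rA / 2), exp_pos (rB / 2)]

/-- Lemma 2.4: uniform moment bound for the dominating process, for N ≥ 8 λ p T. -/
theorem lemma2_4_dominating_process_moment_bound
    (d m : ℕ) (hd : 0 < d) (hm : 0 < m)
    (T K c : ℝ) (hT : 0 < T) (hK : 1 ≤ K) (hc : 1 ≤ c)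
    (ph ps : Vec d → Vec d) (g : Fin m → Vec d → Vec d)
    (hgdiff : ∀ j, ContDiff ℝ 1 (g j))
    (hOSL : ∀ x y : Vec d, ⟪x - y, (ph x + ps x) - (ph y + ps y)⟫ ≤ K * ‖x - y‖ ^ 2)
    (hgLip : ∀ x y : Vec d, ‖Gclm g x - Gclm g y‖ ≤ K * ‖x - y‖)
    (hphLip : ∀ x y : Vec d, ‖ph x - ph y‖ ≤ K * ‖x - y‖)
    (hpsC : ContDiff ℝ 1 ps)
    (hps' : ∀ x : Vec d, ‖fderiv ℝ ps x‖ ≤ K * ‖x‖ ^ c)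
    (hLgLip : ∀ (j₁ j₂ : Fin m) (x y : Vec d), ‖Lg g j₁ j₂ x - Lg g j₁ j₂ y‖ ≤ K * ‖x - y‖)
    (μξ : Measure (Vec d)) (hμξprob : IsProbabilityMeasure μξ)
    (hμξmom : ∀ r : ℕ, Integrable (fun x => ‖x‖ ^ r) μξ)
    (p : ℝ) (hp : 1 ≤ p) :
    ∃ B : ℝ, ∀ (N : ℕ), 0 < N → 8 * lamc T K ph ps g * p * T ≤ (N : ℝ) →
      ∀ (Ω : Type) (mΩ : MeasurableSpace Ω) (P : Measure Ω), IsProbabilityMeasure P →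
      ∀ (ξ : Ω → Vec d) (ΔW : ℕ → Ω → Vec m) (Y : ℕ → Ω → Vec d),
        Measurable ξ → (∀ k, Measurable (ΔW k)) →
        Measure.map ξ P = μξ →
        (∀ k, Measure.map (ΔW k) P
            = Measure.map (WithLp.toLp 2)
                (Measure.pi (fun _ : Fin m => gaussianReal 0 (Real.toNNReal (T / N))))) →
        iIndepFun ΔW P →
        IndepFun ξ (fun ω k => ΔW k ω) P →
        (∀ ω, Y 0 ω = ξ ω) →
        (∀ n ω, Y (n + 1) ω = milstep (T / N) ph ps g (Y n ω) (ΔW n ω)) →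
        ∫⁻ ω, ENNReal.ofReal ((Finset.range (N + 1)).sup' Finset.nonempty_range_add_one
            (fun n => |Dproc (lamc T K ph ps g) ‖ξ ω‖ (fun k => ‖ΔW k ω‖ ^ 2)
              (fun k => alph (T / N) g (Y k ω) (ΔW k ω)) n| ^ p)) ∂P
          ≤ ENNReal.ofReal B := by
  set lam := lamc T K ph ps g with hlam
  set C := ⨆ j : Fin m × Fin m, ‖Lg g j.1 j.2 0‖ with hC
  have hC0 : 0 ≤ C := Real.iSup_nonneg fun _ => norm_nonneg _
  have hm1 : (1 : ℝ) ≤ m := by exact_mod_cast hm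
  have hmC : 0 ≤ m * (K + C) := by positivity
  have hmsq : m * (K + C) ≤ (m : ℝ) ^ 2 * (T + 1) * (K + C) := by
    have : (m : ℝ) ≤ (m : ℝ) ^ 2 * (T + 1) := by nlinarith [mul_pos (by linarith : (0 : ℝ) < m) hT]
    gcongr
  have hquad : 4 * (m * (K + C)) ≤ lam ∧ 16 ≤ lam := by
    have hr : 3 + m * (K + C) ≤ 1 + 4 * T * K + 2 * T * (‖ph 0‖ + ‖ps 0‖) + 2 * K
        + 2 * ‖Gclm g 0‖ + (m : ℝ) ^ 2 * (T + 1) * (K + C) := by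
      have : 0 ≤ 4 * T * K + 2 * T * (‖ph 0‖ + ‖ps 0‖) + 2 * ‖Gclm g 0‖ := by positivity
      linarith
    have hmK : 1 ≤ m * (K + C) := by nlinarith
    have hsq : (3 + m * (K + C)) ^ 2 ≤ lam := by
      rw [hlam, lamc]
      gcongr
    constructor <;> nlinarith
  obtain ⟨hquad, hlam16⟩ := hquad
  have hLg : ∀ i j y, ‖Lg g i j y‖ ≤ K * ‖y‖ + C := by
    intro i j y
    have h1 := hLgLip i j y 0
    have h2 := norm_le_norm_sub_add (Lg g i j y) (Lg g i j 0)
    have h3 : ‖Lg g i j 0‖ ≤ C :=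
      le_ciSup (f := fun q : Fin m × Fin m => ‖Lg g q.1 q.2 0‖)
        (Set.finite_range _).bddAbove (i, j)
    rw [sub_zero] at h1
    linarith
  have hgm : ∀ j, Measurable (g j) := fun j => (hgdiff j).continuous.measurable
  have hLgm : ∀ i j, Measurable (Lg g i j) := fun i j =>
    (LipschitzWith.of_dist_le_mul (K := K.toNNReal) fun x y => by
      simpa [dist_eq_norm, Real.coe_toNNReal K (by linarith)] using hLgLip i j x y).continuous.measurable
  have hphm : Measurable ph :=
    (LipschitzWith.of_dist_le_mul (K := K.toNNReal) fun x y => by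
      simpa [dist_eq_norm, Real.coe_toNNReal K (by linarith)] using hphLip x y).continuous.measurable
  have hpsm : Measurable ps := hpsC.continuous.measurable
  set b := 27 / 8 * p * lam with hb
  set V := 6 * p * (K + ‖Gclm g 0‖) with hV
  set C₀ := 7 * m * b + 4 * V ^ 2 + p * lam with hC₀
  have hC₀0 : 0 ≤ C₀ := by positivity
  let G : Vec d → ℝ≥0∞ := fun x => ENNReal.ofReal ((lam + ‖x‖) ^ p)
  have hGm : Measurable G := by fun_prop
  have hGtop : ∫⁻ x, G x ∂μξ < ∞ := lintegral_add_norm_rpow_lt_top hμξmom (by linarith)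
  let D := exp (p * lam + C₀ * T / 2)
  refine ⟨(ENNReal.ofReal D * (2 * ∫⁻ x, G x ∂μξ + 2 * ∫⁻ x, G x ∂μξ)).toReal, ?_⟩
  intro N hN hN8 Ω mΩ P hP ξ ΔW Y hξ hW hξlaw hWlaw hind hξW hY0 hY
  rw [ENNReal.ofReal_toReal (by finiteness)]
  have hN0 : (0 : ℝ) < N := by exact_mod_cast hN
  set h := T / N with hh
  have hh0 : 0 < h := by positivity
  have hplh : p * lam * h ≤ 1 / 8 := by
    rw [hh, ← mul_div_assoc, div_le_iff₀ hN0]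
    linarith
  have hbh : b * h ≤ 27 / 64 := by
    have : b * h = 27 / 8 * (p * lam * h) := by rw [hb]; ring
    linarith
  have hb0 : 0 ≤ b := by positivity
  have hYs : ∀ n ω, Y (n + 1) ω
      = (fun q : Vec d × Vec m => milstep h ph ps g q.1 q.2) (Y n ω, ΔW n ω) := hY
  have hstep := measurable_milstep (h := h) hphm hpsm hgm hLgm
  have halph := measurable_alph (h := h) hgm hLgm
  have hlin := exists_abs_alph_sub_inner_le (K := K) (by linarith) hh0.le hgLip hLg hC0
  have hrem : ∀ {y : Vec d} {v w : Vec m},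
      |alph h g y w - ⟪v, w⟫| ≤ m * (K + C) / 2 * (‖w‖ ^ 2 + h) →
      |alph h g y w - ⟪v, w⟫| ≤ lam / 8 * (‖w‖ ^ 2 + h) := by
    intro y v w hvw
    exact hvw.trans (mul_le_mul_of_nonneg_right (by linarith) (by positivity))
  have hp0 : 0 < p := by linarith
  let eA : Vec d × Vec m → ℝ := fun q =>
    3 * p * (lam * ‖q.2‖ ^ 2 + alph h g q.1 q.2) - C₀ * h
  let eB : Vec d × Vec m → ℝ := fun q => 6 * p * (-alph h g q.1 q.2) - C₀ * h
  have heA : Measurable eA := by fun_prop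
  have heB : Measurable eB := by fun_prop
  have hAle : ∀ y, ∫⁻ w, ENNReal.ofReal (exp (eA (y, w))) ∂(gaussianVec m h) ≤ 1 := by
    intro y
    obtain ⟨v, hv, hvw⟩ := hlin y
    refine lintegral_exp_gaussianVec_le_one (v := (3 * p) • v) (c := p * lam) hb0 hh0 hbh
      (V := V) ?_ fun w => ?_
    · rw [norm_smul, Real.norm_of_nonneg (by positivity)]
      rw [hV]
      gcongr
      norm_num
    · have h1 := mul_le_mul_of_nonneg_left (le_of_abs_le (hrem (hvw w))) hp0.le
      have h2 : 0 ≤ p * lam * h := by positivity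
      simp only [eA, real_inner_smul_left, ← hC₀]
      rw [hb]
      nlinarith
  have hBle : ∀ y, ∫⁻ w, ENNReal.ofReal (exp (eB (y, w))) ∂(gaussianVec m h) ≤ 1 := by
    intro y
    obtain ⟨v, hv, hvw⟩ := hlin y
    refine lintegral_exp_gaussianVec_le_one (v := (-(6 * p)) • v) (c := p * lam) hb0 hh0 hbh
      (V := V) ?_ fun w => ?_
    · rw [norm_smul, norm_neg, Real.norm_of_nonneg (by positivity), hV]
      gcongr
    · have h1 := mul_le_mul_of_nonneg_left (neg_le_of_abs_le (hrem (hvw w))) hp0.le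
      have h2 : 0 ≤ p * lam * h := by positivity
      have h3 : 0 ≤ p * lam * ‖w‖ ^ 2 := by positivity
      simp only [eB, real_inner_smul_left, ← hC₀]
      rw [hb]
      nlinarith
  have hIA := lintegral_exp_half_partialSups_le hξ hW hWlaw hind hξW measurable_id hstep hY0 hYs
    heA hGm hAle N
  have hIB := lintegral_exp_half_partialSups_le hξ hW hWlaw hind hξW measurable_id hstep hY0 hYs
    heB hGm hBle N
  have hGξ : ∫⁻ ω, G (ξ ω) ∂P = ∫⁻ x, G x ∂μξ := by rw [← hξlaw, lintegral_map hGm hξ]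
  rw [hGξ] at hIA hIB
  have hsum : ∀ (F : ℕ → ℝ) (a : ℝ), ∀ n ≤ N, a * ∑ k ∈ Finset.range n, F k
      ≤ partialSups (fun j => ∑ k ∈ Finset.range j, (a * F k - C₀ * h)) N + C₀ * T := by
    intro F a n hn
    have h1 := le_partialSups_of_le (fun j => ∑ k ∈ Finset.range j, (a * F k - C₀ * h)) hn
    rw [Finset.sum_sub_distrib, ← Finset.mul_sum, Finset.sum_const, Finset.card_range,
      nsmul_eq_mul] at h1
    have h2 : (n : ℝ) * (C₀ * h) ≤ C₀ * T := by
      have : C₀ * T = N * (C₀ * h) := by rw [hh]; field_simp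
      rw [this]
      gcongr
    linarith
  calc _ ≤ ∫⁻ ω, ENNReal.ofReal D * (
        G (ξ ω) * ENNReal.ofReal (exp (partialSups
          (fun j => ∑ k ∈ Finset.range j, eA (Y k ω, ΔW k ω)) N / 2))
        + G (ξ ω) * ENNReal.ofReal (exp (partialSups
          (fun j => ∑ k ∈ Finset.range j, eB (Y k ω, ΔW k ω)) N / 2))) ∂P := by
        refine lintegral_mono fun ω => ?_
        rw [← mul_add, ← ENNReal.ofReal_add (exp_pos _).le (exp_pos _).le,
          ← ENNReal.ofReal_mul (by positivity), ← ENNReal.ofReal_mul (exp_pos _).le]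
        exact ENNReal.ofReal_le_ofReal (sup'_abs_Dproc_rpow_le (by linarith) (norm_nonneg _)
          hp0.le (fun k => by positivity) (hsum _ _) (hsum _ _))
    _ = ENNReal.ofReal D * (_ + _) := by
        rw [lintegral_const_mul' _ _ ENNReal.ofReal_ne_top, lintegral_add_left]
        have hYm : ∀ n, Measurable (Y n) := by
          intro n
          induction n with
          | zero => rw [funext hY0]; exact hξ
          | succ n ih => rw [funext (hYs n)]; fun_prop
        have hsup : ∀ n, Measurable fun ω =>
            partialSups (fun j => ∑ k ∈ Finset.range j, eA (Y k ω, ΔW k ω)) n := by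
          intro n
          induction n with
          | zero => simp
          | succ n ih => simp only [partialSups_add_one]; fun_prop
        fun_prop
    _ ≤ _ := by gcongr
end
end

section
/- Let h > 0, m ≥ 1, p ≥ 1, and let ΔW : Ω → ℝ^m be a random vector whose law is the m-fold product of the real Gaussian measure with mean 0 and variance h; write ΔW^j for its coordinates. Then (1/2)·Σ_{j₁,j₂=1}^m ‖ΔW^{j₁}ΔW^{j₂} − δ_{j₁,j₂}h‖_{L^p(Ω;ℝ)} ≤ c_{p,m}·h, where c_{p,m} = ((m²−m)/2)·p² + 2mp² + m/2. (Inequality (2.32).) -/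
open MeasureTheory ProbabilityTheory Real Finset
open scoped RealInnerProductSpace ENNReal NNReal

noncomputable section

/-- An integrable majorant `F` of `|f| ^ p` with `∫ F ≤ C ^ p` bounds the
`L^p` seminorm of `f` by `C`. -/
theorem eLpNorm_le_ofReal_of_integral_le {α : Type*} {mα : MeasurableSpace α} {μ : Measure α}
    {f F : α → ℝ} {p C : ℝ} (hp : 0 < p) (hC : 0 ≤ C) (hF : Integrable F μ)
    (hfF : ∀ x, |f x| ^ p ≤ F x) (hint : ∫ x, F x ∂μ ≤ C ^ p) :
    eLpNorm f (ENNReal.ofReal p) μ ≤ ENNReal.ofReal C := by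
  rw [eLpNorm_eq_lintegral_rpow_enorm_toReal (by simpa using hp) ENNReal.ofReal_ne_top,
    ENNReal.toReal_ofReal hp.le, one_div, ENNReal.rpow_inv_le_iff hp,
    ENNReal.ofReal_rpow_of_nonneg hC hp.le]
  calc ∫⁻ x, ‖f x‖ₑ ^ p ∂μ ≤ ∫⁻ x, ENNReal.ofReal (F x) ∂μ := by
        refine lintegral_mono fun x => ?_
        rw [← ofReal_norm, ENNReal.ofReal_rpow_of_nonneg (norm_nonneg _) hp.le]
        exact ENNReal.ofReal_le_ofReal (hfF x)
    _ = ENNReal.ofReal (∫ x, F x ∂μ) := by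
        rw [ofReal_integral_eq_lintegral_ofReal hF]
        exact Filter.Eventually.of_forall fun x =>
          (Real.rpow_nonneg (abs_nonneg _) _).trans (hfF x)
    _ ≤ ENNReal.ofReal (C ^ p) := ENNReal.ofReal_le_ofReal hint

theorem abs_rpow_le_mul_exp_add_exp {p s : ℝ} (hp : 0 < p) (hs : 0 < s) (x : ℝ) :
    |x| ^ p ≤ (p * s) ^ p * exp (-p) * (exp (s⁻¹ * x) + exp (-s⁻¹ * x)) := by
  have key : |x| ≤ p * s * exp (|x| / (p * s) - 1) := by
    have h1 := add_one_le_exp (|x| / (p * s) - 1)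
    have h2 : |x| = p * s * (|x| / (p * s)) := by field_simp
    calc |x| = p * s * (|x| / (p * s)) := h2
      _ ≤ _ := by gcongr; linarith
  have hexp : exp (s⁻¹ * |x|) ≤ exp (s⁻¹ * x) + exp (-s⁻¹ * x) := by
    rcases abs_cases x with ⟨h, _⟩ | ⟨h, _⟩ <;> rw [h]
    · linarith [exp_pos (-s⁻¹ * x)]
    · rw [mul_neg, ← neg_mul]
      linarith [exp_pos (s⁻¹ * x)]
  calc |x| ^ p ≤ (p * s * exp (|x| / (p * s) - 1)) ^ p :=
        Real.rpow_le_rpow (abs_nonneg _) key hp.le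
    _ = (p * s) ^ p * exp (-p) * exp (s⁻¹ * |x|) := by
        rw [Real.mul_rpow (by positivity) (exp_pos _).le, ← Real.exp_mul, mul_assoc, ← Real.exp_add]
        congr 2
        field_simp
        ring
    _ ≤ _ := by gcongr

theorem two_mul_exp_half_sub_le_one {p : ℝ} (hp : 2 ≤ p) : 2 * exp (1 / 2 - p) ≤ 1 := by
  have h1 : (2 : ℝ) ≤ exp (p - 1 / 2) := by linarith [add_one_le_exp (p - 1 / 2)]
  have h2 : exp (p - 1 / 2) * exp (1 / 2 - p) = 1 := by
    rw [← Real.exp_add]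
    simp
  nlinarith [exp_pos (1 / 2 - p)]

theorem eLpNorm_id_gaussianReal_le_of_two_le {v : ℝ≥0} (hv : v ≠ 0) {p : ℝ} (hp : 2 ≤ p) :
    eLpNorm id (ENNReal.ofReal p) (gaussianReal 0 v) ≤ ENNReal.ofReal (p * √v) := by
  have hp0 : 0 < p := by linarith
  have hv0 : (0 : ℝ) < v := by exact_mod_cast pos_iff_ne_zero.mpr hv
  have hs : 0 < √(v : ℝ) := Real.sqrt_pos.mpr hv0
  have hmgf : ∀ t : ℝ, ∫ x, exp (t * x) ∂gaussianReal 0 v = exp (v * t ^ 2 / 2) := fun t => by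
    have := mgf_gaussianReal (X := id) (p := gaussianReal 0 v) (μ := 0) (v := v) (by simp) t
    simpa [mgf] using this
  have hval : (v : ℝ) * (√(v : ℝ))⁻¹ ^ 2 / 2 = 1 / 2 := by
    rw [inv_pow, Real.sq_sqrt hv0.le, mul_inv_cancel₀ hv0.ne']
  refine eLpNorm_le_ofReal_of_integral_le hp0 (by positivity)
    (((integrable_exp_mul_gaussianReal _).add (integrable_exp_mul_gaussianReal _)).const_mul _)
    (abs_rpow_le_mul_exp_add_exp hp0 hs) ?_
  simp only [Pi.add_apply]
  rw [integral_const_mul, integral_add (integrable_exp_mul_gaussianReal _)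
    (integrable_exp_mul_gaussianReal _), hmgf, hmgf, neg_sq, hval]
  have h1 := two_mul_exp_half_sub_le_one hp
  rw [sub_eq_add_neg, Real.exp_add] at h1
  have h2 : 0 ≤ (p * √(v : ℝ)) ^ p := by positivity
  nlinarith [mul_le_mul_of_nonneg_left h1 h2]

theorem eLpNorm_two_id_gaussianReal_le (v : ℝ≥0) :
    eLpNorm id 2 (gaussianReal 0 v) ≤ ENNReal.ofReal (√v) := by
  have hvar : ∫ x, x ^ 2 ∂gaussianReal 0 v = v := by
    have h := variance_id_gaussianReal (μ := 0) (v := v)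
    rw [variance_of_integral_eq_zero (by fun_prop) (by simp)] at h
    simpa using h
  have hint : Integrable (fun x : ℝ => x ^ 2) (gaussianReal 0 v) :=
    (memLp_id_gaussianReal 2).integrable_sq
  have := eLpNorm_le_ofReal_of_integral_le (f := id) (p := 2) (C := √v) two_pos
    (Real.sqrt_nonneg _) hint (by simp) (by simp [hvar])
  simpa using this

/-- The `L^p` norm of a centred real Gaussian is at most `p` times its standard deviation. -/
theorem eLpNorm_id_gaussianReal_le {v : ℝ≥0} (hv : v ≠ 0) {p : ℝ} (hp : 1 ≤ p) :
    eLpNorm id (ENNReal.ofReal p) (gaussianReal 0 v) ≤ ENNReal.ofReal (p * √v) := by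
  rcases le_total 2 p with h2 | h2
  · exact eLpNorm_id_gaussianReal_le_of_two_le hv h2
  · calc eLpNorm id (ENNReal.ofReal p) (gaussianReal 0 v)
        ≤ eLpNorm id 2 (gaussianReal 0 v) :=
          eLpNorm_le_eLpNorm_of_exponent_le (ENNReal.ofReal_le_of_le_toReal (by simpa using h2))
            (by fun_prop)
      _ ≤ ENNReal.ofReal (√v) := eLpNorm_two_id_gaussianReal_le v
      _ ≤ ENNReal.ofReal (p * √v) :=
          ENNReal.ofReal_le_ofReal (le_mul_of_one_le_left (Real.sqrt_nonneg _) hp)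

theorem eLpNorm_mul_of_indepFun {Ω : Type*} {mΩ : MeasurableSpace Ω} {P : Measure Ω}
    {X Y : Ω → ℝ} (hX : Measurable X) (hY : Measurable Y) (hXY : IndepFun X Y P)
    {p : ℝ≥0∞} (hp : p ≠ 0) (hp' : p ≠ ∞) :
    eLpNorm (fun ω => X ω * Y ω) p P = eLpNorm X p P * eLpNorm Y p P := by
  simp only [eLpNorm_eq_lintegral_rpow_enorm_toReal hp hp', enorm_mul,
    ENNReal.mul_rpow_of_nonneg _ _ ENNReal.toReal_nonneg]
  have hφ : Measurable fun x : ℝ => ‖x‖ₑ ^ p.toReal := by fun_prop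
  have hprod := lintegral_mul_eq_lintegral_mul_lintegral_of_indepFun''
    (hφ.comp hX).aemeasurable (hφ.comp hY).aemeasurable (hXY.comp hφ hφ)
  simp only [Function.comp_apply] at hprod
  rw [hprod, ENNReal.mul_rpow_of_nonneg _ _ (by positivity)]

theorem eLpNorm_sq_sub_const_le {Ω : Type*} {mΩ : MeasurableSpace Ω} {P : Measure Ω}
    [IsProbabilityMeasure P] {X : Ω → ℝ} (hX : Measurable X) {p h : ℝ} (hp : 1 ≤ p) (hh : 0 ≤ h) :
    eLpNorm (fun ω => X ω * X ω - h) (ENNReal.ofReal p) P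
      ≤ eLpNorm X (ENNReal.ofReal (2 * p)) P ^ 2 + ENNReal.ofReal h := by
  have hp0 : 0 < p := by linarith
  have hsq : eLpNorm (fun ω => X ω * X ω) (ENNReal.ofReal p) P
      = eLpNorm X (ENNReal.ofReal (2 * p)) P ^ 2 := by
    have := eLpNorm_norm_rpow (μ := P) (p := ENNReal.ofReal p) X (two_pos : (0 : ℝ) < 2)
    rw [← ENNReal.ofReal_mul hp0.le, mul_comm p] at this
    simpa [← sq] using this
  calc eLpNorm (fun ω => X ω * X ω - h) (ENNReal.ofReal p) P
      ≤ eLpNorm (fun ω => X ω * X ω) (ENNReal.ofReal p) P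
          + eLpNorm (fun _ : Ω => h) (ENNReal.ofReal p) P :=
        eLpNorm_sub_le (by fun_prop) (by fun_prop) (by simpa using hp)
    _ = _ := by
        rw [hsq, eLpNorm_const _ (by simpa using hp0) (NeZero.ne P)]
        simp [Real.enorm_of_nonneg hh]

theorem map_coordinates_eq_pi {m : ℕ} {Ω : Type*} {mΩ : MeasurableSpace Ω} {P : Measure Ω}
    {W : Ω → Vec m} (hW : Measurable W) {μ : Measure (Fin m → ℝ)}
    (hlaw : Measure.map W P = Measure.map (WithLp.toLp 2) μ) :
    Measure.map (fun ω i => W ω i) P = μ := by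
  have h := congrArg (Measure.map (WithLp.ofLp : Vec m → Fin m → ℝ)) hlaw
  rw [Measure.map_map (by fun_prop) hW, Measure.map_map (by fun_prop) (by fun_prop)] at h
  have hid : (WithLp.ofLp : Vec m → Fin m → ℝ) ∘ WithLp.toLp 2 = id := rfl
  rw [hid, Measure.map_id] at h
  exact h

theorem map_coordinate_eq {m : ℕ} {Ω : Type*} {mΩ : MeasurableSpace Ω} {P : Measure Ω}
    {X : Fin m → Ω → ℝ} (hX : ∀ i, Measurable (X i)) {μ : Fin m → Measure ℝ}
    [∀ i, IsProbabilityMeasure (μ i)]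
    (hlaw : Measure.map (fun ω i => X i ω) P = Measure.pi μ) (i : Fin m) :
    Measure.map (X i) P = μ i := by
  rw [← (measurePreserving_eval μ i).map_eq, ← hlaw,
    Measure.map_map (measurable_pi_apply i) (by fun_prop)]
  rfl

/-- Inequality (2.32): the L^p norms of the Milstein Brownian-increment products satisfy
(1/2) Σ_{j₁,j₂} ‖ΔW^{j₁}ΔW^{j₂} - δ_{j₁,j₂} h‖_{L^p} ≤ c_{p,m} h
with c_{p,m} = ((m²-m)/2) p² + 2 m p² + m/2. -/
theorem increments_product_Lp_bound
    (m : ℕ) (hm : 0 < m) (h p : ℝ) (hh : 0 < h) (hp : 1 ≤ p)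
    (Ω : Type) (mΩ : MeasurableSpace Ω) (P : Measure Ω) (hP : IsProbabilityMeasure P)
    (ΔW : Ω → Vec m) (hmeas : Measurable ΔW)
    (hlaw : Measure.map ΔW P
      = Measure.map (WithLp.toLp 2)
          (Measure.pi (fun _ : Fin m => gaussianReal 0 (Real.toNNReal h)))) :
    (2⁻¹ : ℝ≥0∞) * ∑ j₁ : Fin m, ∑ j₂ : Fin m,
        eLpNorm (fun ω => ΔW ω j₁ * ΔW ω j₂ - (if j₁ = j₂ then h else 0))
          (ENNReal.ofReal p) P
      ≤ ENNReal.ofReal ((((m : ℝ) ^ 2 - m) / 2 * p ^ 2 + 2 * m * p ^ 2 + m / 2) * h) := by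
  have hp0 : 0 < p := by linarith
  have hv : h.toNNReal ≠ 0 := by simpa using hh
  have hvh : ((h.toNNReal : ℝ≥0) : ℝ) = h := Real.coe_toNNReal h hh.le
  have hX : ∀ j, Measurable fun ω => ΔW ω j := fun j => by fun_prop
  have hpi := map_coordinates_eq_pi hmeas hlaw
  have hmarg := map_coordinate_eq hX hpi
  have hind : iIndepFun (fun j ω => ΔW ω j) P := by
    rw [iIndepFun_iff_map_fun_eq_pi_map fun j => (hX j).aemeasurable, hpi]
    simp_rw [hmarg]
  have hnorm : ∀ j, ∀ q : ℝ, 1 ≤ q →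
      eLpNorm (fun ω => ΔW ω j) (ENNReal.ofReal q) P ≤ ENNReal.ofReal (q * √h) := by
    intro j q hq
    have hbd := eLpNorm_id_gaussianReal_le hv hq
    rw [hvh, ← hmarg j, eLpNorm_map_measure (by fun_prop) (hX j).aemeasurable] at hbd
    exact hbd
  have hterm : ∀ j₁ j₂ : Fin m,
      eLpNorm (fun ω => ΔW ω j₁ * ΔW ω j₂ - (if j₁ = j₂ then h else 0)) (ENNReal.ofReal p) P
        ≤ ENNReal.ofReal (p ^ 2 * h + if j₁ = j₂ then (3 * p ^ 2 + 1) * h else 0) := by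
    intro j₁ j₂
    by_cases hj : j₁ = j₂
    · subst hj
      simp only [if_true]
      calc _ ≤ _ := eLpNorm_sq_sub_const_le (hX j₁) hp hh.le
        _ ≤ ENNReal.ofReal (2 * p * √h) ^ 2 + ENNReal.ofReal h := by
          gcongr
          exact hnorm j₁ (2 * p) (by linarith)
        _ = _ := by
          rw [← ENNReal.ofReal_pow (by positivity), ← ENNReal.ofReal_add (by positivity) hh.le,
            mul_pow, Real.sq_sqrt hh.le]
          congr 1
          ring
    · simp only [hj, if_false, sub_zero, add_zero]
      rw [eLpNorm_mul_of_indepFun (hX j₁) (hX j₂) (hind.indepFun hj) (by simpa using hp0)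
        ENNReal.ofReal_ne_top]
      calc _ ≤ ENNReal.ofReal (p * √h) * ENNReal.ofReal (p * √h) :=
            mul_le_mul' (hnorm j₁ p hp) (hnorm j₂ p hp)
        _ = _ := by
          rw [← ENNReal.ofReal_mul (by positivity), ← sq, mul_pow, Real.sq_sqrt hh.le]
  have hnonneg : ∀ j₁ j₂ : Fin m,
      0 ≤ p ^ 2 * h + if j₁ = j₂ then (3 * p ^ 2 + 1) * h else 0 := fun j₁ j₂ => by
    split_ifs <;> positivity
  have htwo : (2⁻¹ : ℝ≥0∞) = ENNReal.ofReal 2⁻¹ := by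
    rw [ENNReal.ofReal_inv_of_pos two_pos, ENNReal.ofReal_ofNat]
  calc _ ≤ (2⁻¹ : ℝ≥0∞) * ∑ j₁ : Fin m, ∑ j₂ : Fin m,
        ENNReal.ofReal (p ^ 2 * h + if j₁ = j₂ then (3 * p ^ 2 + 1) * h else 0) := by
        gcongr
        exact hterm _ _
    _ = ENNReal.ofReal (2⁻¹ * ∑ j₁ : Fin m, ∑ j₂ : Fin m,
        (p ^ 2 * h + if j₁ = j₂ then (3 * p ^ 2 + 1) * h else 0)) := by
        rw [ENNReal.ofReal_mul (by norm_num), htwo, ENNReal.ofReal_sum_of_nonneg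
          fun j₁ _ => Finset.sum_nonneg fun j₂ _ => hnonneg j₁ j₂]
        simp_rw [ENNReal.ofReal_sum_of_nonneg fun j₂ _ => hnonneg _ j₂]
    _ ≤ _ := by
        refine ENNReal.ofReal_le_ofReal (le_of_eq ?_)
        simp only [Finset.sum_add_distrib, Finset.sum_const, Finset.sum_ite_eq, Finset.mem_univ,
          if_true, Finset.card_univ, Fintype.card_fin, nsmul_eq_mul]
        ring
end
end
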